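/- arXiv:1302.2338 — 7 statements merged into one kernel-verified Lean document; each statement's English description precedes it below -/
import Mathlib

section
/- Let M be a loopless matroid on a finite ground set E, and suppose M is k-colorable, i.e., E can be partitioned into at most k independent sets of M. If every element e ∈ E is assigned a finite list L(e) ⊆ ℕ of colors with |L(e)| ≥ k, then there exists a proper coloring c of M with c(e) ∈ L(e) for every e ∈ E. (Seymour's theorem on list coloring of matroids.) -/
/-- **Rado's theorem**, in its form for monotone submodular functions: a family of finite sets
satisfying the Hall-type condition with respect to `f` can be shrunk to a family of singletons
satisfying the same condition. -/
theorem exists_singleton_refinement_of_card_le_submodular {ι β : Type*} [DecidableEq β]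
    (f : Finset β → ℕ) (f_empty : f ∅ = 0) (f_mono : Monotone f)
    (f_submod : ∀ A B, f (A ∪ B) + f (A ∩ B) ≤ f A + f B) (s : Finset ι) (A : ι → Finset β)
    (hA : ∀ X ⊆ s, X.card ≤ f (X.biUnion A)) :
    ∃ A' : ι → Finset β, (∀ i ∈ s, A' i ⊆ A i ∧ ∃ b, A' i = {b}) ∧
      ∀ X ⊆ s, X.card ≤ f (X.biUnion A') := by
  classical
  induction hn : ∑ i ∈ s, (A i).card using Nat.strong_induction_on generalizing A with
  | _ n ih =>
  by_cases hsing : ∀ i ∈ s, ∃ b, A i = {b}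
  · exact ⟨A, fun i hi => ⟨subset_rfl, hsing i hi⟩, hA⟩
  push Not at hsing
  obtain ⟨i, hi, hns⟩ := hsing
  have hne : (A i).Nonempty := by
    rw [Finset.nonempty_iff_ne_empty]
    intro h
    have := hA {i} (by simpa using hi)
    simp [h, f_empty] at this
  have hnt : (A i).Nontrivial := by
    rw [← Finset.one_lt_card_iff_nontrivial]
    have h1 : (A i).card ≠ 1 := fun h => by
      obtain ⟨b, hb⟩ := Finset.card_eq_one.1 h
      exact hns b hb
    have := hne.card_pos
    omega
  obtain ⟨a, ha, b, hb, hab⟩ := hnt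
  let R : β → ι → Finset β := fun x => Function.update A i ((A i).erase x)
  have R_sub : ∀ x j, R x j ⊆ A j := by
    intro x j
    by_cases hj : j = i
    · subst hj
      simpa [R] using Finset.erase_subset _ _
    · simp [R, hj]
  have shrink : ∀ x ∈ A i, (∀ X ⊆ s, X.card ≤ f (X.biUnion (R x))) →
      ∃ A' : ι → Finset β, (∀ i ∈ s, A' i ⊆ A i ∧ ∃ b, A' i = {b}) ∧
        ∀ X ⊆ s, X.card ≤ f (X.biUnion A') := by
    intro x hx hR
    have hlt : ∑ j ∈ s, (R x j).card < n := by
      rw [← hn]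
      refine Finset.sum_lt_sum (fun j _ => Finset.card_le_card (R_sub x j)) ⟨i, hi, ?_⟩
      simpa [R] using Finset.card_erase_lt_of_mem hx
    obtain ⟨A', h1, h2⟩ := ih _ hlt (R x) hR rfl
    exact ⟨A', fun j hj => ⟨(h1 j hj).1.trans (R_sub x j), (h1 j hj).2⟩, h2⟩
  by_contra hcon
  have violated : ∀ x ∈ A i, ∃ X ⊆ s, i ∈ X ∧ f (X.biUnion (R x)) < X.card := by
    intro x hx
    by_contra! h
    refine hcon (shrink x hx fun X hX => ?_)
    by_cases hiX : i ∈ X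
    · exact h X hX hiX
    · have : X.biUnion (R x) = X.biUnion A := Finset.biUnion_congr rfl fun j hj => by
        have : j ≠ i := fun h => hiX (h ▸ hj)
        simp [R, this]
      rw [this]
      exact hA X hX
  obtain ⟨X, hXs, hiX, hX⟩ := violated a ha
  obtain ⟨Y, hYs, hiY, hY⟩ := violated b hb
  have hU : (X ∪ Y).biUnion A ⊆ X.biUnion (R a) ∪ Y.biUnion (R b) := by
    intro y hy
    obtain ⟨j, hj, hyj⟩ := Finset.mem_biUnion.1 hy
    simp only [Finset.mem_union, Finset.mem_biUnion]
    by_cases hji : j = i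
    · subst hji
      by_cases hya : y = a
      · exact .inr ⟨j, hiY, by simpa [R, hya, hab] using ha⟩
      · exact .inl ⟨j, hiX, by simp [R, hyj, hya]⟩
    · rcases Finset.mem_union.1 hj with hj | hj
      · exact .inl ⟨j, hj, by simpa [R, hji] using hyj⟩
      · exact .inr ⟨j, hj, by simpa [R, hji] using hyj⟩
  have hI : ((X ∩ Y).erase i).biUnion A ⊆ X.biUnion (R a) ∩ Y.biUnion (R b) := by
    intro y hy
    obtain ⟨j, hj, hyj⟩ := Finset.mem_biUnion.1 hy
    simp only [Finset.mem_erase, Finset.mem_inter] at hj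
    simp only [Finset.mem_inter, Finset.mem_biUnion]
    exact ⟨⟨j, hj.2.1, by simpa [R, hj.1] using hyj⟩, ⟨j, hj.2.2, by simpa [R, hj.1] using hyj⟩⟩
  have h1 := (hA _ (Finset.union_subset hXs hYs)).trans (f_mono hU)
  have h2 := (hA _ ((Finset.erase_subset i _).trans
    (Finset.inter_subset_left.trans hXs))).trans (f_mono hI)
  rw [Finset.card_erase_of_mem (Finset.mem_inter.2 ⟨hiX, hiY⟩)] at h2
  have h3 := f_submod (X.biUnion (R a)) (Y.biUnion (R b))
  have h4 := Finset.card_union_add_card_inter X Y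
  omega

theorem Matroid.toNat_eRk_mono {α : Type*} (M : Matroid α) {X Y : Set α} (hY : Y.Finite)
    (hXY : X ⊆ Y) : (M.eRk X).toNat ≤ (M.eRk Y).toNat :=
  ENat.toNat_le_toNat (M.eRk_mono hXY) (M.isRkFinite_of_finite hY).eRk_lt_top.ne

theorem Matroid.toNat_eRk_submod {α : Type*} (M : Matroid α) {X Y : Set α} (hX : X.Finite)
    (hY : Y.Finite) :
    (M.eRk (X ∪ Y)).toNat + (M.eRk (X ∩ Y)).toNat ≤ (M.eRk X).toNat + (M.eRk Y).toNat := by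
  have hfin : ∀ {Z : Set α}, Z.Finite → M.eRk Z ≠ ⊤ := fun hZ =>
    (M.isRkFinite_of_finite hZ).eRk_lt_top.ne
  rw [← ENat.toNat_add (hfin (hX.union hY)) (hfin (hX.inter_of_left Y)),
    ← ENat.toNat_add (hfin hX) (hfin hY), add_comm]
  exact ENat.toNat_le_toNat (M.eRk_inter_add_eRk_union_le X Y)
    (WithTop.add_ne_top.2 ⟨hfin hX, hfin hY⟩)

/-- A Hall-type rank condition on the lists guarantees a proper list coloring: if for every `X`
the ranks of the sets of elements of `X` admitting each color add up to at least `|X|`,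
then colors can be chosen from the lists so that the color classes are independent. -/
theorem Matroid.exists_list_coloring_of_card_le_sum_eRk {α κ : Type*} [Nonempty κ]
    [DecidableEq κ] (M : Matroid α) (E : Finset α) (L : α → Finset κ) (h : ∀ X ⊆ E,
      X.card ≤ ∑ i ∈ E.biUnion L, (M.eRk {e | e ∈ X ∧ i ∈ L e}).toNat) :
    ∃ c : α → κ, (∀ e ∈ E, c e ∈ L e) ∧ ∀ i, M.Indep {e | e ∈ E ∧ c e = i} := by
  classical
  have fibre_finite : ∀ (i : κ) (B : Finset (κ × α)), {x | (i, x) ∈ B}.Finite := fun i B =>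
    (B.image Prod.snd).finite_toSet.subset fun x hx =>
      Finset.mem_coe.2 (Finset.mem_image_of_mem Prod.snd hx)
  obtain ⟨A', hA', hcard⟩ := exists_singleton_refinement_of_card_le_submodular
    (fun B : Finset (κ × α) => ∑ i ∈ E.biUnion L, (M.eRk {x | (i, x) ∈ B}).toNat)
    (by simp)
    (fun A B hAB => Finset.sum_le_sum fun i _ =>
      M.toNat_eRk_mono (fibre_finite i B) fun x hx => hAB hx)
    (fun A B => by
      simp only [← Finset.sum_add_distrib]
      refine Finset.sum_le_sum fun i _ => ?_
      simpa only [Finset.mem_union, Finset.mem_inter, Set.ofPred_or, Set.ofPred_and] using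
        M.toNat_eRk_submod (fibre_finite i A) (fibre_finite i B))
    E (fun e => L e ×ˢ {e})
    (fun X hX => by
      refine (h X hX).trans (le_of_eq (Finset.sum_congr rfl fun i _ => ?_))
      congr 2
      ext x
      simp only [Set.mem_ofPred_eq, Finset.mem_biUnion, Finset.mem_product, Finset.mem_singleton]
      exact ⟨fun hx => ⟨x, hx.1, hx.2, rfl⟩, by rintro ⟨e, he, hi, rfl⟩; exact ⟨he, hi⟩⟩)
  have hex : ∀ e ∈ E, ∃ i, i ∈ L e ∧ A' e = {(i, e)} := by
    intro e he
    obtain ⟨hsub, ⟨i, x⟩, hb⟩ := hA' e he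
    have hmem : (i, x) ∈ L e ×ˢ ({e} : Finset α) := hsub (by simp [hb])
    obtain ⟨hi, rfl⟩ : i ∈ L e ∧ x = e := by simpa [eq_comm] using hmem
    exact ⟨i, hi, hb⟩
  choose! c hcL hcA using hex
  refine ⟨c, hcL, fun i => ?_⟩
  let X := E.filter (c · = i)
  have hXeq : {e | e ∈ E ∧ c e = i} = (X : Set α) := by
    ext
    simp [X]
  have hfib : ∀ j, {x | (j, x) ∈ X.biUnion A'} ⊆ {x | x ∈ X ∧ j = i} := by
    intro j x hx
    obtain ⟨e, he, hx⟩ := Finset.mem_biUnion.1 hx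
    obtain ⟨heE, hei⟩ := Finset.mem_filter.1 he
    rw [hcA e heE, Finset.mem_singleton, Prod.mk.injEq] at hx
    exact ⟨hx.2 ▸ he, hx.1.trans hei⟩
  have hle : X.card ≤ (M.eRk X).toNat := by
    calc X.card ≤ ∑ j ∈ E.biUnion L, (M.eRk {x | (j, x) ∈ X.biUnion A'}).toNat :=
          hcard X (Finset.filter_subset _ _)
      _ ≤ ∑ j ∈ E.biUnion L, if j = i then (M.eRk X).toNat else 0 := by
          refine Finset.sum_le_sum fun j _ => ?_
          split_ifs with hj
          · exact M.toNat_eRk_mono X.finite_toSet fun x hx => (hfib j hx).1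
          · rw [Set.subset_eq_empty (hfib j) (by simp [hj])]
            simp
      _ ≤ (M.eRk X).toNat := by
          rw [Finset.sum_ite_eq']
          split_ifs <;> simp
  have hX := M.isRkFinite_of_finite X.finite_toSet
  rw [hXeq]
  refine hX.indep_of_encard_le_eRk ?_
  rw [Set.encard_coe_eq_coe_finsetCard, ← ENat.natCast_toNat hX.eRk_lt_top.ne]
  exact_mod_cast hle

theorem Matroid.card_le_mul_toNat_eRk {α : Type*} (M : Matroid α) {k : ℕ} (c : α → ℕ)
    (X : Finset α) (hck : ∀ e ∈ X, c e < k) (hc : ∀ i, M.Indep {e | e ∈ X ∧ c e = i}) :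
    X.card ≤ k * (M.eRk X).toNat := by
  classical
  rw [Finset.card_eq_sum_card_fiberwise (f := c) (t := Finset.range k)
    fun e he => by simpa using hck e he]
  refine (Finset.sum_le_card_nsmul _ _ (M.eRk X).toNat fun i _ => ?_).trans (by simp)
  have hXi : {e | e ∈ X ∧ c e = i} = (X.filter (c · = i) : Set α) := by
    ext
    simp
  have hind := (hXi ▸ hc i).eRk_eq_encard
  rw [Set.encard_coe_eq_coe_finsetCard] at hind
  have := M.toNat_eRk_mono X.finite_toSet (Finset.coe_subset.2 (X.filter_subset (c · = i)))
  rwa [hind, ENat.toNat_natCast] at this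

/-- **Seymour's theorem on list coloring of matroids.**
Let `M` be a loopless matroid on a finite ground set. If `M` is `k`-colorable
(its ground set is the union of `k` independent sets, i.e. there is a proper coloring
using at most `k` colors), and every element `e` of the ground set is assigned a finite
list `L e ⊆ ℕ` with `|L e| ≥ k`, then there is a proper coloring `c` of `M` with
`c e ∈ L e` for every element `e`. -/
theorem seymour_list_coloring {α : Type*} (M : Matroid α) (hfin : M.E.Finite)
    (hloopless : ∀ e ∈ M.E, M.Indep {e}) (k : ℕ)
    (hcol : ∃ c : α → ℕ, (∀ e ∈ M.E, c e < k) ∧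
      ∀ i : ℕ, M.Indep {e ∈ M.E | c e = i})
    (L : α → Finset ℕ) (hL : ∀ e ∈ M.E, k ≤ (L e).card) :
    ∃ c : α → ℕ, (∀ e ∈ M.E, c e ∈ L e) ∧
      ∀ i : ℕ, M.Indep {e ∈ M.E | c e = i} := by
  classical
  obtain ⟨c, hck, hc⟩ := hcol
  let E := hfin.toFinset
  have hE : ∀ {e}, e ∈ E ↔ e ∈ M.E := hfin.mem_toFinset
  suffices h : ∀ X ⊆ E, X.card ≤ ∑ i ∈ E.biUnion L, (M.eRk {e | e ∈ X ∧ i ∈ L e}).toNat by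
    simpa only [hE] using M.exists_list_coloring_of_card_le_sum_eRk E L h
  intro X hX
  rcases X.eq_empty_or_nonempty with rfl | ⟨x, hx⟩
  · simp
  refine Nat.le_of_mul_le_mul_left ?_ ((Nat.zero_le _).trans_lt (hck x (hE.1 (hX hx))))
  calc k * X.card ≤ ∑ e ∈ X, (L e).card := by
        rw [mul_comm]
        exact Finset.card_nsmul_le_sum X _ k fun e he => hL e (hE.1 (hX he))
    _ = ∑ e ∈ X, ((E.biUnion L).filter (· ∈ L e)).card := by
        refine Finset.sum_congr rfl fun e he => congrArg _ ?_
        rw [Finset.filter_mem_eq_inter,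
          Finset.inter_eq_right.2 (Finset.subset_biUnion_of_mem L (hX he))]
    _ = ∑ i ∈ E.biUnion L, (X.filter (i ∈ L ·)).card :=
        Finset.sum_card_bipartiteAbove_eq_sum_card_bipartiteBelow fun e i => i ∈ L e
    _ ≤ ∑ i ∈ E.biUnion L, k * (M.eRk {e | e ∈ X ∧ i ∈ L e}).toNat := by
        refine Finset.sum_le_sum fun i _ => ?_
        have hXE : ∀ e ∈ X.filter (i ∈ L ·), e ∈ M.E := fun e he =>
          hE.1 (hX (Finset.mem_of_mem_filter e he))
        simpa using M.card_le_mul_toNat_eRk c (X.filter (i ∈ L ·))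
          (fun e he => hck e (hXE e he))
          fun j => (hc j).subset fun e he => ⟨hXE e he.1, he.2⟩
    _ = k * ∑ i ∈ E.biUnion L, (M.eRk {e | e ∈ X ∧ i ∈ L e}).toNat := (Finset.mul_sum ..).symm
end

section
/- Let I₁ and I₂ be disjoint independent sets of a matroid M with rank function r, let X ⊆ I₁, let M₁ be the restriction of M to X ∪ I₂ and M₂ the restriction of M to (I₁ \ X) ∪ I₂, with rank functions r₁ and r₂ respectively. Then for every subset A ⊆ I₁ ∪ I₂ one has r₁(A) + r₂(A) ≥ |A|. -/
/-- The rank of a set `A` in a matroid `M`: the maximum cardinality of an independent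
subset of `A`. -/
noncomputable def matroidRank {α : Type*} (M : Matroid α) (A : Set α) : ℕ :=
  sSup {n : ℕ | ∃ I, I ⊆ A ∧ M.Indep I ∧ I.ncard = n}

/-- On a matroid with finite ground set, `matroidRank` agrees with `Matroid.eRk`. -/
lemma coe_matroidRank_eq_eRk {α : Type*} (M : Matroid α) (hfin : M.E.Finite) (A : Set α) :
    (matroidRank M A : ℕ∞) = M.eRk A := by
  obtain ⟨J, hJ⟩ := M.exists_isBasis' A
  have hJfin : J.Finite := hfin.subset hJ.indep.subset_ground
  have hmax : IsGreatest {n : ℕ | ∃ I, I ⊆ A ∧ M.Indep I ∧ I.ncard = n} J.ncard := by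
    refine ⟨⟨J, hJ.subset, hJ.indep, rfl⟩, ?_⟩
    rintro _ ⟨I, hIA, hI, rfl⟩
    have h := hI.encard_le_eRk_of_subset hIA
    rw [← hJ.encard_eq_eRk, ← (hfin.subset hI.subset_ground).cast_ncard_eq,
      ← hJfin.cast_ncard_eq] at h
    exact_mod_cast h
  rw [matroidRank, hmax.csSup_eq, hJfin.cast_ncard_eq, hJ.encard_eq_eRk]

/-- Let `I₁` and `I₂` be disjoint independent sets of a matroid `M` on a finite ground
set, let `X ⊆ I₁`, let `M₁` be the restriction of `M` to `X ∪ I₂` and `M₂` the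
restriction of `M` to `(I₁ \ X) ∪ I₂`; the rank function of the restriction of `M` to a
set `S`, evaluated at `A`, is `r (A ∩ S)`.  Then for every `A ⊆ I₁ ∪ I₂` we have
`r₁(A) + r₂(A) ≥ |A|`. -/
theorem rank_sum_ge_card {α : Type*} (M : Matroid α) (hfin : M.E.Finite)
    (I₁ I₂ : Set α) (hI₁ : M.Indep I₁) (hI₂ : M.Indep I₂)
    (hdisj : Disjoint I₁ I₂) (X : Set α) (hX : X ⊆ I₁)
    (A : Set α) (hA : A ⊆ I₁ ∪ I₂) :
    A.ncard ≤ matroidRank M (A ∩ (X ∪ I₂)) + matroidRank M (A ∩ ((I₁ \ X) ∪ I₂)) := by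
  have hAfin : A.Finite := hfin.subset
    (hA.trans (Set.union_subset hI₁.subset_ground hI₂.subset_ground))
  have hunion : A ∩ (X ∪ I₂) ∪ A ∩ ((I₁ \ X) ∪ I₂) = A := by
    rw [← Set.inter_union_distrib_left, ← Set.union_union_distrib_right,
      Set.union_sdiff_cancel hX, Set.inter_eq_left.2 hA]
  have hinter : A ∩ I₂ ⊆ A ∩ (X ∪ I₂) ∩ (A ∩ ((I₁ \ X) ∪ I₂)) := by
    grind
  have hcover : A ⊆ A ∩ I₁ ∪ A ∩ I₂ := by
    rw [← Set.inter_union_distrib_left]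
    exact Set.subset_inter subset_rfl hA
  have key : (A.ncard : ℕ∞) ≤
      matroidRank M (A ∩ (X ∪ I₂)) + matroidRank M (A ∩ ((I₁ \ X) ∪ I₂)) := by
    rw [coe_matroidRank_eq_eRk M hfin, coe_matroidRank_eq_eRk M hfin, hAfin.cast_ncard_eq]
    calc A.encard ≤ (A ∩ I₂).encard + (A ∩ I₁).encard := by
          rw [add_comm]
          exact (Set.encard_le_encard hcover).trans (Set.encard_union_le _ _)
      _ ≤ M.eRk (A ∩ (X ∪ I₂) ∩ (A ∩ ((I₁ \ X) ∪ I₂))) +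
          M.eRk (A ∩ (X ∪ I₂) ∪ A ∩ ((I₁ \ X) ∪ I₂)) :=
        add_le_add ((hI₂.subset Set.inter_subset_right).encard_le_eRk_of_subset hinter)
          ((hI₁.subset Set.inter_subset_right).encard_le_eRk_of_subset
            (hunion.symm ▸ Set.inter_subset_left))
      _ ≤ _ := M.eRk_inter_add_eRk_union_le _ _
  exact_mod_cast key
end

section
/- Let I₁, …, I_k be independent sets of a matroid M on a finite ground set E forming a w-cover of E, where w : E → ℕ. Then for every subset V ⊆ E there exist an independent set I ⊆ V and independent sets I₁′, …, I_k′ of M such that: (1) I₁′, …, I_k′ form a (w − 𝐜_I)-cover of E, where 𝐜_I is the characteristic function of I; and (2) for each e ∈ E, if e ∈ I_s′ then e ∈ I_t for some index t ≥ s + 𝐜_V(e), where 𝐜_V is the characteristic function of V. -/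
/-- A Hall-type theorem for two submodular set functions. -/
theorem Finset.exists_subset_card_le_of_submodular {α : Type*} [DecidableEq α]
    (f g : Finset α → ℤ)
    (hf : ∀ X Z, f (X ∪ Z) + f (X ∩ Z) ≤ f X + f Z)
    (hg : ∀ X Z, g (X ∪ Z) + g (X ∩ Z) ≤ g X + g Z)
    (c : ℤ) (Y : Finset α) (h : ∀ X ⊆ Y, (X.card : ℤ) + c ≤ f X + g X) :
    ∃ Z ⊆ Y, (Y.card : ℤ) + c ≤ f Z + g (Y \ Z) := by
  induction Y using Finset.induction_on generalizing f g c with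
  | empty => exact ⟨∅, by simp, by simpa using h ∅ (by simp)⟩
  | insert y Y hy ih =>
    have hins : ∀ f : Finset α → ℤ, (∀ X Z, f (X ∪ Z) + f (X ∩ Z) ≤ f X + f Z) →
        ∀ X Z, f (insert y (X ∪ Z)) + f (insert y (X ∩ Z)) ≤
          f (insert y X) + f (insert y Z) := fun f hf X Z ↦ by
      rw [Finset.insert_union_distrib, Finset.insert_inter_distrib]
      exact hf _ _
    by_cases h₁ : ∀ X ⊆ Y, (X.card : ℤ) + (c + 1) ≤ f (insert y X) + g X
    · obtain ⟨Z, hZ, hle⟩ := ih (fun X ↦ f (insert y X)) g (hins f hf) hg (c + 1) h₁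
      refine ⟨insert y Z, Finset.insert_subset_insert y hZ, ?_⟩
      have : insert y Y \ insert y Z = Y \ Z := by grind
      rw [this, Finset.card_insert_of_notMem hy]
      push_cast
      linarith
    by_cases h₂ : ∀ X ⊆ Y, (X.card : ℤ) + (c + 1) ≤ f X + g (insert y X)
    · obtain ⟨Z, hZ, hle⟩ := ih f (fun X ↦ g (insert y X)) hf (hins g hg) (c + 1) h₂
      refine ⟨Z, hZ.trans (Finset.subset_insert y Y), ?_⟩
      have : insert y Y \ Z = insert y (Y \ Z) := by grind
      rw [this, Finset.card_insert_of_notMem hy]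
      push_cast
      linarith
    push Not at h₁ h₂
    obtain ⟨X₁, hX₁, h₁⟩ := h₁
    obtain ⟨X₂, hX₂, h₂⟩ := h₂
    have hf' := hf (insert y X₁) X₂
    have hg' := hg X₁ (insert y X₂)
    rw [Finset.insert_union, Finset.insert_inter_of_notMem (fun h ↦ hy (hX₂ h))] at hf'
    rw [Finset.union_insert, Finset.inter_insert_of_notMem (fun h ↦ hy (hX₁ h))] at hg'
    have hunion := h (insert y (X₁ ∪ X₂))
      (Finset.insert_subset_insert y (Finset.union_subset hX₁ hX₂))
    have hinter := h (X₁ ∩ X₂)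
      (Finset.inter_subset_left.trans (hX₁.trans (Finset.subset_insert y Y)))
    rw [Finset.card_insert_of_notMem (by grind)] at hunion
    have hcard := Finset.card_union_add_card_inter X₁ X₂
    zify at hcard
    push_cast at hunion
    linarith

/-- Multiple exchange for independent sets: if a disjoint union `A ∪ B` is independent, any
independent set splits into two parts which extend `A` and `B`, respectively. -/
theorem Matroid.Indep.exists_split {α : Type*} {M : Matroid α} [M.RankFinite] {A B Y : Set α}
    (hAB : M.Indep (A ∪ B)) (hdisj : Disjoint A B) (hY : M.Indep Y) :
    ∃ Z ⊆ Y, Disjoint A Z ∧ M.Indep (A ∪ Z) ∧ Disjoint B (Y \ Z) ∧ M.Indep (B ∪ Y \ Z) := by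
  classical
  have hA := hAB.subset Set.subset_union_left
  have hB := hAB.subset Set.subset_union_right
  lift A to Finset α using hA.finite
  lift B to Finset α using hB.finite
  lift Y to Finset α using hY.finite
  let r : Finset α → ℕ := fun X ↦ (M.eRk (X : Set α)).toNat
  have hr : ∀ X, (r X : ℕ∞) = M.eRk (X : Set α) := fun X ↦
    ENat.natCast_toNat (Matroid.eRk_ne_top_iff.2 (M.isRkFinite_set _))
  have hsub : ∀ X Z, r (X ∪ Z) + r (X ∩ Z) ≤ r X + r Z := fun X Z ↦ by
    have := M.eRk_inter_add_eRk_union_le (X : Set α) (Z : Set α)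
    rw [← Finset.coe_union, ← Finset.coe_inter, ← hr, ← hr, ← hr, ← hr] at this
    norm_cast at this
    omega
  have hmono : ∀ {X Z}, X ⊆ Z → r X ≤ r Z := fun {X Z} h ↦ by
    have := M.eRk_mono (Finset.coe_subset.2 h)
    rw [← hr, ← hr] at this
    exact_mod_cast this
  have hle : ∀ X, r X ≤ X.card := fun X ↦ by
    have := M.eRk_le_encard (X : Set α)
    rw [← hr, Set.encard_coe_eq_coe_finsetCard] at this
    exact_mod_cast this
  have hindep : ∀ X : Finset α, M.Indep (X : Set α) ↔ r X = X.card := fun X ↦ by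
    rw [Matroid.indep_iff_eRk_eq_encard_of_finite X.finite_toSet, ← hr,
      Set.encard_coe_eq_coe_finsetCard]
    norm_cast
  have hdisj' : Disjoint A B := by exact_mod_cast hdisj
  have hABr : r (A ∪ B) = A.card + B.card := by
    rwa [← Finset.card_union_of_disjoint hdisj', ← hindep, Finset.coe_union]
  have hunion : ∀ C X Z : Finset α, (r (C ∪ (X ∪ Z)) : ℤ) + r (C ∪ (X ∩ Z)) ≤
      r (C ∪ X) + r (C ∪ Z) := fun C X Z ↦ by
    have := hsub (C ∪ X) (C ∪ Z)
    rw [← Finset.union_union_distrib_left, ← Finset.union_inter_distrib_left] at this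
    exact_mod_cast this
  obtain ⟨Z, hZ, hZle⟩ := Finset.exists_subset_card_le_of_submodular
    (fun X ↦ (r (A ∪ X) : ℤ)) (fun X ↦ (r (B ∪ X) : ℤ)) (hunion A) (hunion B)
    (A.card + B.card) Y fun X hX ↦ by
      have h₁ := hsub (A ∪ X) (B ∪ X)
      have h₂ : r (A ∪ B) ≤ r (A ∪ X ∪ (B ∪ X)) := hmono (by grind)
      have h₃ : r X ≤ r ((A ∪ X) ∩ (B ∪ X)) := hmono (by grind)
      have h₄ := (hindep X).1 (hY.subset (Finset.coe_subset.2 hX))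
      omega
  have hYcard := Finset.card_sdiff_add_card_eq_card hZ
  have h₁ := hle (A ∪ Z)
  have h₂ := hle (B ∪ Y \ Z)
  have h₃ := Finset.card_union_add_card_inter A Z
  have h₄ := Finset.card_union_add_card_inter B (Y \ Z)
  refine ⟨Z, Finset.coe_subset.2 hZ, ?_, ?_, ?_, ?_⟩
  · rw [Finset.disjoint_coe, Finset.disjoint_iff_inter_eq_empty, ← Finset.card_eq_zero]
    omega
  · rw [← Finset.coe_union, hindep]
    omega
  · rw [← Finset.coe_sdiff, Finset.disjoint_coe, Finset.disjoint_iff_inter_eq_empty,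
      ← Finset.card_eq_zero]
    omega
  · rw [← Finset.coe_sdiff, ← Finset.coe_union, hindep]
    omega

open Classical in
/-- The cover statement in additive form; the extra clause `J ⊆ ⋃ t, I t` makes it inductive. -/
theorem Matroid.exists_shifted_cover {α : Type*} (M : Matroid α) [M.RankFinite] (V : Set α)
    (k : ℕ) (I : Fin k → Set α) (hind : ∀ i, M.Indep (I i)) :
    ∃ J : Set α, J ⊆ V ∧ M.Indep J ∧ J ⊆ ⋃ t, I t ∧
      ∃ I' : Fin k → Set α, (∀ s, M.Indep (I' s)) ∧
        (∀ e, (∑ s, if e ∈ I' s then 1 else 0) + (if e ∈ J then 1 else 0) =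
          ∑ s, if e ∈ I s then 1 else 0) ∧
        (∀ e s, e ∈ I' s →
          ∃ t : Fin k, (s : ℕ) + (if e ∈ V then 1 else 0) ≤ (t : ℕ) ∧ e ∈ I t) := by
  induction k with
  | zero => exact ⟨∅, by simp, by simp, by simp, I, by simp⟩
  | succ k ih =>
    obtain ⟨J, hJV, hJ, hJI, I', hI', hsum, hshift⟩ := ih (fun i ↦ I i.succ) fun i ↦ hind _
    have hdisj : Disjoint (I 0 ∩ V) (I 0 \ V) := Set.disjoint_sdiff_inter.symm
    obtain ⟨Z, hZJ, hZ₁, hZ₂, hZ₃, hZ₄⟩ :=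
      Matroid.Indep.exists_split (by rw [Set.inter_union_sdiff]; exact hind 0) hdisj hJ
    refine ⟨I 0 ∩ V ∪ Z, Set.union_subset Set.inter_subset_right (hZJ.trans hJV), hZ₂, ?_,
      Fin.cons (I 0 \ V ∪ J \ Z) I', ?_, ?_, ?_⟩
    · refine Set.union_subset (Set.inter_subset_left.trans (Set.subset_iUnion I 0)) ?_
      exact (hZJ.trans hJI).trans (Set.iUnion_subset fun i ↦ Set.subset_iUnion I i.succ)
    · exact Fin.cases hZ₄ hI'
    · intro e
      have h := hsum e
      rw [Fin.sum_univ_succ, Fin.sum_univ_succ, ← h]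
      simp only [Fin.cons_zero, Fin.cons_succ]
      have h₁ : e ∈ I 0 ∩ V → e ∉ Z := fun h ↦ hZ₁.notMem_of_mem_left h
      have h₂ : e ∈ I 0 \ V → e ∉ J \ Z := fun h ↦ hZ₃.notMem_of_mem_left h
      have h₃ : e ∈ Z → e ∈ J := fun h ↦ hZJ h
      simp only [Set.mem_union, Set.mem_inter_iff, Set.mem_sdiff] at h₁ h₂ ⊢
      split_ifs <;> first | omega | tauto
    · intro e s
      refine Fin.cases ?_ (fun s hs ↦ ?_) s
      · rintro (⟨he, heV⟩ | ⟨he, -⟩)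
        · exact ⟨0, by simp [heV], he⟩
        · obtain ⟨t, ht⟩ := Set.mem_iUnion.1 (hJI he)
          exact ⟨t.succ, by simp [hJV he], ht⟩
      · obtain ⟨t, ht, he⟩ := hshift e s hs
        exact ⟨t.succ, by simp only [Fin.val_succ]; omega, he⟩

open Classical in
/-- **Inductive step lemma.**  Let `I 0, …, I (k-1)` be independent sets of a matroid
`M` on a finite ground set forming a `w`-cover of the ground set (each element `e`
belongs to exactly `w e` of them).  Then for every `V ⊆ M.E` there exist an independent
set `J ⊆ V` and independent sets `I' 0, …, I' (k-1)` such that: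
(1) the sets `I'` form a `(w - 𝐜_J)`-cover of the ground set, and
(2) for each `e` in the ground set, if `e ∈ I' s` then `e ∈ I t` for some index `t`
with `t ≥ s + 𝐜_V e`, where `𝐜_U` denotes the characteristic function of a set `U`. -/
theorem inductive_step_cover {α : Type*} (M : Matroid α) (hfin : M.E.Finite)
    (k : ℕ) (w : α → ℕ) (I : Fin k → Set α) (hind : ∀ i, M.Indep (I i))
    (hcover : ∀ e ∈ M.E, {i : Fin k | e ∈ I i}.ncard = w e)
    (V : Set α) (hV : V ⊆ M.E) :
    ∃ J : Set α, J ⊆ V ∧ M.Indep J ∧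
      ∃ I' : Fin k → Set α, (∀ s, M.Indep (I' s)) ∧
        (∀ e ∈ M.E, {s : Fin k | e ∈ I' s}.ncard
          = w e - (if e ∈ J then 1 else 0)) ∧
        (∀ e ∈ M.E, ∀ s : Fin k, e ∈ I' s →
          ∃ t : Fin k, (s : ℕ) + (if e ∈ V then 1 else 0) ≤ (t : ℕ) ∧ e ∈ I t) := by
  have : M.Finite := ⟨hfin⟩
  have hncard : ∀ (S : Fin k → Set α) e,
      {s : Fin k | e ∈ S s}.ncard = ∑ s, if e ∈ S s then 1 else 0 := fun S e ↦ by
    rw [Set.ncard_eq_toFinset_card', Set.toFinset_ofPred, Finset.card_filter]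
  obtain ⟨J, hJV, hJ, -, I', hI', hsum, hshift⟩ := M.exists_shifted_cover V k I hind
  refine ⟨J, hJV, hJ, I', hI', fun e he ↦ ?_, fun e _ ↦ hshift e⟩
  rw [← hcover e he, hncard, hncard, ← hsum e, Nat.add_sub_cancel]
end

section
/- Let M be a loopless matroid on a finite ground set E and let w, ℓ : E → ℕ. If M is on-line (w, ℓ)-colorable (Alice has a winning strategy in the on-line list coloring game with weight function w and list-size function ℓ), then M is w-colorable from the lists L(e) = {1, 2, …, ℓ(e)}, e ∈ E. (Necessity of the condition in the main theorem: Bob can reveal the lists {1,…,ℓ(e)} by playing B_i = {e ∈ E : ℓ(e) ≥ i}.) -/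
/-- **Necessity of the condition in the main theorem.**
Let `M` be a loopless matroid on a finite ground set and `w ℓ : E → ℕ`.  Suppose `M` is
on-line `(w, ℓ)`-colorable: Alice has a strategy `str` (giving her move `A i` from
Bob's moves `B 0, …, B i` so far; since the strategy is deterministic, Alice's earlier
moves are determined by Bob's) such that for every complete play `B 0, …, B (n-1)` of
Bob — nonempty subsets of the ground set with every element `e` of the ground set lying
in exactly `ℓ e` of them — Alice's responses `A i` are independent subsets of the
respective `B i`, pairwise disjoint, and every element `e` of the ground set lies in
exactly `w e` of them.  Then `M` is `w`-colorable from the lists `L e = {1, …, ℓ e}`: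
there is `W` with `W e ⊆ {1, …, ℓ e}` and `|W e| = w e` for all `e` in the ground set,
and `{e : i ∈ W e}` independent for every color `i`. -/
theorem colorable_of_online_colorable {α : Type*} (M : Matroid α) (hfin : M.E.Finite)
    (hloopless : ∀ e ∈ M.E, M.Indep {e}) (w l : α → ℕ)
    (honline : ∃ str : (n : ℕ) → (Fin n → Set α) → Set α,
      ∀ (n : ℕ) (B : Fin n → Set α),
        (∀ i : Fin n, (B i).Nonempty ∧ B i ⊆ M.E) →
        (∀ e ∈ M.E, {i : Fin n | e ∈ B i}.ncard = l e) →
        ∀ A : Fin n → Set α,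
          (∀ i : Fin n, A i
            = str ((i : ℕ) + 1) (fun j : Fin ((i : ℕ) + 1) => B (Fin.castLE i.isLt j))) →
          (∀ i : Fin n, M.Indep (A i) ∧ A i ⊆ B i) ∧
          (∀ i j : Fin n, i ≠ j → Disjoint (A i) (A j)) ∧
          (∀ e ∈ M.E, {i : Fin n | e ∈ A i}.ncard = w e)) :
    ∃ W : α → Finset ℕ, (∀ e ∈ M.E, W e ⊆ Finset.Icc 1 (l e)) ∧
      (∀ e ∈ M.E, (W e).card = w e) ∧ ∀ i : ℕ, M.Indep {e ∈ M.E | i ∈ W e} := by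
  classical
  obtain ⟨str, h⟩ := honline
  set n := hfin.toFinset.sup l with hn
  have hle : ∀ e ∈ M.E, l e ≤ n := fun e he =>
    Finset.le_sup (f := l) (hfin.mem_toFinset.mpr he)
  let B : Fin n → Set α := fun i => {e ∈ M.E | (i : ℕ) < l e}
  have hB : ∀ i, (B i).Nonempty ∧ B i ⊆ M.E := by
    refine fun i => ⟨?_, fun e he => he.1⟩
    obtain ⟨e, he, hi⟩ := Finset.lt_sup_iff.mp (i.isLt.trans_eq hn)
    exact ⟨e, hfin.mem_toFinset.mp he, hi⟩
  have hcount : ∀ e ∈ M.E, {i : Fin n | e ∈ B i}.ncard = l e := by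
    intro e he
    have himage : Fin.val '' {i : Fin n | e ∈ B i} = Set.Iio (l e) := by
      ext k
      simp only [Set.mem_image, Set.mem_ofPred_eq, Set.mem_Iio, B]
      constructor
      · rintro ⟨i, hi, rfl⟩
        exact hi.2
      · exact fun hk => ⟨⟨k, hk.trans_le (hle e he)⟩, ⟨he, hk⟩, rfl⟩
    rw [← Set.ncard_image_of_injective _ Fin.val_injective, himage, ← Finset.coe_Iio,
      Set.ncard_coe_finset, Nat.card_Iio]
  let A : Fin n → Set α := fun i =>
    str ((i : ℕ) + 1) (fun j : Fin ((i : ℕ) + 1) => B (Fin.castLE i.isLt j))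
  obtain ⟨hA, -, hw⟩ := h n B hB hcount A (fun _ => rfl)
  refine ⟨fun e => (Finset.univ.filter fun i => e ∈ A i).image fun i : Fin n => (i : ℕ) + 1,
    ?_, ?_, ?_⟩
  · intro e _ k hk
    simp only [Finset.mem_image, Finset.mem_filter, Finset.mem_univ, true_and] at hk
    obtain ⟨i, hi, rfl⟩ := hk
    exact Finset.mem_Icc.mpr ⟨Nat.succ_pos _, ((hA i).2 hi).2⟩
  · intro e he
    rw [Finset.card_image_of_injective _
      fun i j hij => Fin.val_injective (Nat.succ_injective hij), ← hw e he,
      ← Set.ncard_coe_finset]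
    simp
  · intro k
    by_cases hk : ∃ i : Fin n, (i : ℕ) + 1 = k
    · obtain ⟨i, rfl⟩ := hk
      refine (hA i).1.subset ?_
      rintro e ⟨-, he⟩
      simp only [Finset.mem_image, Finset.mem_filter, Finset.mem_univ, true_and] at he
      obtain ⟨j, hj, hji⟩ := he
      rwa [Fin.val_injective (Nat.succ_injective hji)] at hj
    · refine M.empty_indep.subset ?_
      rintro e ⟨-, he⟩
      simp only [Finset.mem_image] at he
      obtain ⟨j, -, hj⟩ := he
      exact hk ⟨j, hj⟩
end

section
/- Every loopless matroid M on a finite ground set satisfies χ̃(M) = χ(M), where χ(M) is the chromatic number of M and χ̃(M) is the on-line list chromatic number: the least k such that Alice has a winning strategy in the following game. In round i = 1, 2, …, Bob picks a nonempty set B_i ⊆ E and Alice responds with an independent set A_i ⊆ B_i disjoint from A₁ ∪ … ∪ A_{i−1} (chosen via a strategy depending on the history); Bob's choices are constrained so that each element e lies in at most k of the sets B_i, and the game ends when every element lies in exactly k of them; Alice wins if A₁ ∪ A₂ ∪ … = E. -/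
/-- The chromatic number `χ(M)` of a matroid `M`: the least `k` such that the ground
set admits a proper coloring with `k` colors, i.e. is the union of `k` independent
sets. -/
noncomputable def matroidChromaticNumber {α : Type*} (M : Matroid α) : ℕ :=
  sInf {k : ℕ | ∃ c : α → ℕ, (∀ e ∈ M.E, c e < k) ∧
    ∀ i : ℕ, M.Indep {e ∈ M.E | c e = i}}

/-- Alice has a winning strategy in the on-line list coloring game on the matroid `M`
with lists of size `k`: there is a strategy `str` (giving Alice's move `A i` from Bob's
moves `B 0, …, B i` so far; since the strategy is deterministic, Alice's earlier moves
are determined by Bob's) such that for every complete play `B 0, …, B (n-1)` of Bob —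
nonempty subsets of the ground set with every element of the ground set lying in
exactly `k` of them (hence in at most `k` of them at any point of the game) — Alice's
responses `A i` are independent subsets of the respective `B i`, pairwise disjoint, and
their union is the whole ground set. -/
def matroidOnlineChoosable {α : Type*} (M : Matroid α) (k : ℕ) : Prop :=
  ∃ str : (n : ℕ) → (Fin n → Set α) → Set α,
    ∀ (n : ℕ) (B : Fin n → Set α),
      (∀ i : Fin n, (B i).Nonempty ∧ B i ⊆ M.E) →
      (∀ e ∈ M.E, {i : Fin n | e ∈ B i}.ncard = k) →
      ∀ A : Fin n → Set α,
        (∀ i : Fin n, A i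
          = str ((i : ℕ) + 1) (fun j : Fin ((i : ℕ) + 1) => B (Fin.castLE i.isLt j))) →
        (∀ i : Fin n, M.Indep (A i) ∧ A i ⊆ B i) ∧
        (∀ i j : Fin n, i ≠ j → Disjoint (A i) (A j)) ∧
        (⋃ i : Fin n, A i) = M.E

/-- The on-line list chromatic number `χ̃(M)`: the least `k` such that Alice has a
winning strategy in the on-line list coloring game with lists of size `k`. -/
noncomputable def matroidOnlineChromaticNumber {α : Type*} (M : Matroid α) : ℕ :=
  sInf {k : ℕ | matroidOnlineChoosable M k}

section OnlineColoring

open scoped Classical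
open Finset

variable {α ι : Type*}

/-- One deletion step in Rado's argument: if a submodular Hall condition holds and `e` lies in both
`R i` and `R j`, then `e` can be removed from one of the two. -/
lemma hall_erase_or_hall_erase [DecidableEq ι] {ρ : Finset α → ℕ} (hmono : Monotone ρ)
    (hsub : ∀ X Y, ρ (X ∩ Y) + ρ (X ∪ Y) ≤ ρ X + ρ Y) {S : Finset α} {I : Finset ι}
    {R : ι → Finset α} (hR : ∀ T ⊆ S, #T ≤ ∑ l ∈ I, ρ (T ∩ R l)) (e : α) {i j : ι} (hij : i ≠ j) :
    (∀ T ⊆ S, #T ≤ ∑ l ∈ I, ρ (T ∩ Function.update R i ((R i).erase e) l)) ∨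
      ∀ T ⊆ S, #T ≤ ∑ l ∈ I, ρ (T ∩ Function.update R j ((R j).erase e) l) := by
  by_contra! h
  obtain ⟨⟨T₁, hT₁, h₁⟩, ⟨T₂, hT₂, h₂⟩⟩ := h
  have mem_of_lt {T : Finset α} {m : ι} (hT : T ⊆ S)
      (h : ∑ l ∈ I, ρ (T ∩ Function.update R m ((R m).erase e) l) < #T) : e ∈ T := by
    by_contra he
    refine (h.trans_le (hR T hT)).ne (sum_congr rfl fun l _ ↦ ?_)
    congr 1
    ext x
    rcases eq_or_ne l m with rfl | hl
    · simp only [Function.update_self, mem_inter, mem_erase]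
      grind
    · simp [Function.update_of_ne hl]
  have he₁ := mem_of_lt hT₁ h₁
  have he₂ := mem_of_lt hT₂ h₂
  have key (l : ι) : ρ ((T₁ ∩ T₂).erase e ∩ R l) + ρ ((T₁ ∪ T₂) ∩ R l) ≤
      ρ (T₁ ∩ Function.update R i ((R i).erase e) l) +
        ρ (T₂ ∩ Function.update R j ((R j).erase e) l) := by
    refine (Nat.add_le_add (hmono ?_) (hmono ?_)).trans (hsub _ _)
    all_goals
      intro x hx
      simp only [Function.update_apply, mem_inter, mem_union]
      grind
  have hsum := sum_le_sum fun l (_ : l ∈ I) ↦ key l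
  rw [sum_add_distrib, sum_add_distrib] at hsum
  have hinter := hR ((T₁ ∩ T₂).erase e)
    ((erase_subset _ _).trans (inter_subset_left.trans hT₁))
  have hunion := hR (T₁ ∪ T₂) (union_subset hT₁ hT₂)
  have hcard := card_union_add_card_inter T₁ T₂
  have herase := card_erase_add_one (mem_inter.2 ⟨he₁, he₂⟩)
  lia

/-- **Rado's theorem** in covering form, for a submodular function `ρ`: if every `T ⊆ S` satisfies
`#T ≤ ∑ i, ρ (T ∩ R i)`, then `S` can be coloured so that the elements of colour `i` lie in `R i`
and number at most the value of `ρ` on their set. -/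
theorem exists_coloring_of_hall [Nonempty ι] [DecidableEq ι] {ρ : Finset α → ℕ} (hempty : ρ ∅ = 0) (hmono : Monotone ρ)
    (hsub : ∀ X Y, ρ (X ∩ Y) + ρ (X ∪ Y) ≤ ρ X + ρ Y) {S : Finset α} {I : Finset ι}
    (R : ι → Finset α) (hR : ∀ T ⊆ S, #T ≤ ∑ l ∈ I, ρ (T ∩ R l)) :
    ∃ c : α → ι, (∀ e ∈ S, c e ∈ I ∧ e ∈ R (c e)) ∧
      ∀ i ∈ I, #{e ∈ S | c e = i} ≤ ρ {e ∈ S | c e = i} := by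
  induction hn : ∑ l ∈ I, #(R l) using Nat.strong_induction_on generalizing R with
  | _ n ih =>
    by_cases hdup : ∃ e, ∃ i ∈ I, ∃ j ∈ I, i ≠ j ∧ e ∈ R i ∧ e ∈ R j
    · obtain ⟨e, i, hi, j, hj, hij, hei, hej⟩ := hdup
      have erase_case {m : ι} (hm : m ∈ I) (hem : e ∈ R m)
          (h : ∀ T ⊆ S, #T ≤ ∑ l ∈ I, ρ (T ∩ Function.update R m ((R m).erase e) l)) :
          ∃ c : α → ι, (∀ e ∈ S, c e ∈ I ∧ e ∈ R (c e)) ∧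
            ∀ i ∈ I, #{e ∈ S | c e = i} ≤ ρ {e ∈ S | c e = i} := by
        have hle (l : ι) : Function.update R m ((R m).erase e) l ⊆ R l := by
          rcases eq_or_ne l m with rfl | hl
          · simpa using erase_subset _ _
          · simp [Function.update_of_ne hl]
        have hlt : ∑ l ∈ I, #(Function.update R m ((R m).erase e) l) < n := by
          rw [← hn]
          refine sum_lt_sum (fun l _ ↦ card_le_card (hle l)) ⟨m, hm, ?_⟩
          simpa using card_erase_lt_of_mem hem
        obtain ⟨c, hc, hcard⟩ := ih _ hlt _ h rfl
        exact ⟨c, fun x hx ↦ ⟨(hc x hx).1, hle _ (hc x hx).2⟩, hcard⟩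
      rcases hall_erase_or_hall_erase hmono hsub hR e hij with h | h
      · exact erase_case hi hei h
      · exact erase_case hj hej h
    · push Not at hdup
      have hex (e : α) (he : e ∈ S) : ∃ i, i ∈ I ∧ e ∈ R i := by
        by_contra! h
        have hle := hR {e} (by simpa using he)
        rw [sum_eq_zero fun l hl ↦ by rw [singleton_inter_of_notMem (h l hl), hempty]] at hle
        simp at hle
      choose! c hc using hex
      refine ⟨c, hc, fun i hi ↦ (hR _ (filter_subset _ _)).trans ?_⟩
      rw [sum_eq_single_of_mem i hi]
      · exact hmono inter_subset_left
      · intro j hj hji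
        rw [← hempty]
        congr 1
        ext x
        simp only [mem_inter, mem_filter, notMem_empty, iff_false]
        rintro ⟨⟨hx, rfl⟩, hxj⟩
        exact hdup x _ hi j hj hji.symm (hc x hx).2 hxj

/-- `M.eRk` on finite sets, as a natural number. -/
noncomputable def finsetRank (M : Matroid α) (X : Finset α) : ℕ := (M.eRk X).toNat

lemma coe_finsetRank (M : Matroid α) (X : Finset α) : (finsetRank M X : ℕ∞) = M.eRk X :=
  ENat.natCast_toNat (ne_top_of_le_ne_top (by simp) (M.eRk_le_encard X))

lemma finsetRank_mono (M : Matroid α) : Monotone (finsetRank M) := fun X Y h ↦ by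
  have := M.eRk_mono (coe_subset.2 h)
  rwa [← coe_finsetRank, ← coe_finsetRank, Nat.cast_le] at this

lemma finsetRank_submod (M : Matroid α) (X Y : Finset α) :
    finsetRank M (X ∩ Y) + finsetRank M (X ∪ Y) ≤ finsetRank M X + finsetRank M Y := by
  have := M.eRk_inter_add_eRk_union_le X Y
  rw [← coe_inter, ← coe_union] at this
  simp only [← coe_finsetRank] at this
  exact_mod_cast this

lemma finsetRank_eq_card {M : Matroid α} {X : Finset α} (h : M.Indep X) :
    finsetRank M X = #X := by
  simp [finsetRank, h.eRk_eq_encard]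

lemma indep_of_card_le_finsetRank {M : Matroid α} {X : Finset α} (h : #X ≤ finsetRank M X) :
    M.Indep X := by
  rw [Matroid.indep_iff_eRk_eq_encard_of_finite X.finite_toSet]
  refine (M.eRk_le_encard X).antisymm ?_
  rw [← coe_finsetRank, Set.encard_coe_eq_coe_finsetCard]
  exact_mod_cast h

/-- The finite set `U` has a proper coloring giving each `e` a color smaller than `r e`. -/
def BoundedColorable (M : Matroid α) (U : Finset α) (r : α → ℕ) : Prop :=
  ∃ c : α → ℕ, (∀ e ∈ U, c e < r e) ∧ ∀ i, M.Indep {e ∈ U | c e = i}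

/-- The number of remaining occurrences of each element after Bob plays `B`. -/
noncomputable def remaining (r : α → ℕ) (B : Set α) (e : α) : ℕ := if e ∈ B then r e - 1 else r e

/-- Telescoping sum of submodular inequalities along the level sets of `r`. -/
lemma sum_level_le (M : Matroid α) (T : Finset α) (r : α → ℕ) (B : Set α) (n : ℕ) :
    ∑ j ∈ range n, finsetRank M {e ∈ T | j < r e} + finsetRank M {e ∈ T | n < r e ∧ e ∈ B} ≤
      finsetRank M {e ∈ T | e ∈ B} +
        ∑ j ∈ range n, finsetRank M {e ∈ T | j < remaining r B e} := by
  induction n with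
  | zero =>
    simp only [range_zero, sum_empty, zero_add, add_zero]
    exact finsetRank_mono M fun e he ↦ by grind
  | succ n ih =>
    have h := finsetRank_submod M {e ∈ T | n < r e ∧ e ∈ B} {e ∈ T | n < remaining r B e}
    have h_inter : ({e ∈ T | n < r e ∧ e ∈ B} ∩ {e ∈ T | n < remaining r B e} : Finset α) =
        {e ∈ T | n + 1 < r e ∧ e ∈ B} := by
      ext e
      simp only [mem_inter, mem_filter, remaining]
      grind
    have h_union : ({e ∈ T | n < r e ∧ e ∈ B} ∪ {e ∈ T | n < remaining r B e} : Finset α) =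
        {e ∈ T | n < r e} := by
      ext e
      simp only [mem_union, mem_filter, remaining]
      grind
    rw [h_inter, h_union] at h
    rw [sum_range_succ, sum_range_succ]
    lia

/-- The key step: Alice can answer every move `B` of Bob by an independent set while preserving
bounded colorability of the remaining elements. -/
lemma BoundedColorable.exists_move {M : Matroid α} {U : Finset α} {r : α → ℕ}
    (h : BoundedColorable M U r) (B : Set α) :
    ∃ A ⊆ U, ↑A ⊆ B ∧ M.Indep A ∧ BoundedColorable M (U \ A) (remaining r B) := by
  obtain ⟨c, hc, hcI⟩ := h
  set N := ∑ e ∈ U, r e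
  have hrN {e : α} (he : e ∈ U) : r e ≤ N := single_le_sum (fun _ _ ↦ Nat.zero_le _) he
  let R : ℕ → Finset α
    | 0 => {e ∈ U | e ∈ B}
    | j + 1 => {e ∈ U | j < remaining r B e}
  have hall : ∀ T ⊆ U, #T ≤ ∑ l ∈ range (N + 1), finsetRank M (T ∩ R l) := by
    intro T hT
    have hTc : #T ≤ ∑ j ∈ range N, finsetRank M {e ∈ T | j < r e} := by
      rw [card_eq_sum_card_fiberwise (f := c) (t := range N)
        fun e he ↦ by simpa using (hc e (hT he)).trans_le (hrN (hT he))]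
      refine sum_le_sum fun j _ ↦ ?_
      rw [← finsetRank_eq_card ((hcI j).subset fun e he ↦ ?_)]
      · exact finsetRank_mono M fun e he ↦ by grind
      · simp at he ⊢
        grind
    have hlev := sum_level_le M T r B N
    have h0 : T ∩ R 0 = {e ∈ T | e ∈ B} := by ext; simp [R]; grind
    have hs (j : ℕ) : T ∩ R (j + 1) = {e ∈ T | j < remaining r B e} := by ext; simp [R]; grind
    rw [sum_range_succ', h0]
    simp only [hs]
    lia
  obtain ⟨d, hd, hdI⟩ := exists_coloring_of_hall (by simp [finsetRank]) (finsetRank_mono M)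
    (finsetRank_submod M) R hall
  have hind (i : ℕ) : M.Indep ({e ∈ U | d e = i} : Finset α) := by
    by_cases hi : i ∈ range (N + 1)
    · exact indep_of_card_le_finsetRank (hdI i hi)
    · rw [filter_false_of_mem (p := (d · = i)) fun e he hde ↦ hi (hde ▸ (hd e he).1)]
      simp
  refine ⟨{e ∈ U | d e = 0}, filter_subset _ _, fun e he ↦ ?_, hind 0, fun e ↦ d e - 1,
    fun e he ↦ ?_, fun i ↦ (hind (i + 1)).subset fun e he ↦ ?_⟩
  · have he' := mem_filter.1 (mem_coe.1 he)
    have := (hd e he'.1).2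
    rw [he'.2] at this
    exact (mem_filter.1 this).2
  · obtain ⟨heU, hde⟩ : e ∈ U ∧ d e ≠ 0 := by grind
    obtain ⟨j, hj⟩ := Nat.exists_eq_succ_of_ne_zero hde
    have := (hd e heU).2
    rw [hj] at this
    simpa [hj] using (mem_filter.1 this).2
  · simp at he ⊢
    grind

/-- Alice's answer to `B` when the elements of `U` are uncolored and `r` counts the remaining
occurrences. -/
noncomputable def aliceMove (M : Matroid α) (U : Finset α) (r : α → ℕ) (B : Set α) : Finset α :=
  if h : BoundedColorable M U r then (h.exists_move B).choose else ∅

/-- The uncolored elements and the remaining occurrences after `n` rounds in which Bob plays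
`B 0, …, B (n - 1)`. -/
noncomputable def gameState (M : Matroid α) (U : Finset α) (r : α → ℕ) (B : ℕ → Set α) :
    ℕ → Finset α × (α → ℕ)
  | 0 => (U, r)
  | n + 1 =>
    let s := gameState M U r B n
    (s.1 \ aliceMove M s.1 s.2 (B n), remaining s.2 (B n))

/-- Alice's answer in round `n` against the sequence `B` of moves of Bob. -/
noncomputable def aliceAnswer (M : Matroid α) (U : Finset α) (r : α → ℕ) (B : ℕ → Set α) (n : ℕ) :
    Finset α :=
  aliceMove M (gameState M U r B n).1 (gameState M U r B n).2 (B n)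

lemma gameState_congr (M : Matroid α) (U : Finset α) (r : α → ℕ) {B B' : ℕ → Set α} {n : ℕ}
    (h : ∀ i < n, B i = B' i) : gameState M U r B n = gameState M U r B' n := by
  induction n with
  | zero => rfl
  | succ n ih => simp [gameState, ih fun i hi ↦ h i (by lia), h n (by lia)]

lemma aliceAnswer_congr (M : Matroid α) (U : Finset α) (r : α → ℕ) {B B' : ℕ → Set α} {n : ℕ}
    (h : ∀ i ≤ n, B i = B' i) : aliceAnswer M U r B n = aliceAnswer M U r B' n := by
  rw [aliceAnswer, aliceAnswer, gameState_congr M U r fun i hi ↦ h i hi.le, h n le_rfl]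

lemma BoundedColorable.aliceMove_spec {M : Matroid α} {U : Finset α} {r : α → ℕ}
    (h : BoundedColorable M U r) (B : Set α) :
    aliceMove M U r B ⊆ U ∧ ↑(aliceMove M U r B) ⊆ B ∧ M.Indep (aliceMove M U r B) ∧
      BoundedColorable M (U \ aliceMove M U r B) (remaining r B) := by
  rw [aliceMove, dif_pos h]
  exact (h.exists_move B).choose_spec

lemma BoundedColorable.of_gameState {M : Matroid α} {U : Finset α} {r : α → ℕ}
    (h : BoundedColorable M U r) (B : ℕ → Set α) (n : ℕ) :
    BoundedColorable M (gameState M U r B n).1 (gameState M U r B n).2 := by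
  induction n with
  | zero => exact h
  | succ n ih => exact (ih.aliceMove_spec (B n)).2.2.2

lemma gameState_fst_antitone (M : Matroid α) (U : Finset α) (r : α → ℕ) (B : ℕ → Set α) :
    Antitone fun n ↦ (gameState M U r B n).1 :=
  antitone_nat_of_succ_le fun _ ↦ sdiff_subset

lemma mem_gameState_fst {M : Matroid α} {U : Finset α} {r : α → ℕ} {B : ℕ → Set α} {n : ℕ} {e : α} :
    e ∈ (gameState M U r B n).1 ↔ e ∈ U ∧ ∀ i < n, e ∉ aliceAnswer M U r B i := by
  induction n with
  | zero => simp [gameState]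
  | succ n ih =>
    rw [Nat.forall_lt_succ_right, ← and_assoc, ← ih]
    simp [gameState, aliceAnswer]

lemma gameState_snd (M : Matroid α) (U : Finset α) (r : α → ℕ) (B : ℕ → Set α) (n : ℕ) (e : α) :
    (gameState M U r B n).2 e = r e - #{i ∈ range n | e ∈ B i} := by
  induction n with
  | zero => simp [gameState]
  | succ n ih =>
    by_cases he : e ∈ B n
    · simp [gameState, remaining, he, ih, range_add_one, filter_insert]
      lia
    · simp [gameState, remaining, he, ih, range_add_one, filter_insert]

/-- Bob's first `n` moves, continued by empty moves. -/
def extendMoves {n : ℕ} (B : Fin n → Set α) (i : ℕ) : Set α :=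
  if h : i < n then B ⟨i, h⟩ else ∅

theorem BoundedColorable.matroidOnlineChoosable {M : Matroid α} (hfin : M.E.Finite) {k : ℕ}
    (h : BoundedColorable M hfin.toFinset fun _ ↦ k) : matroidOnlineChoosable M k := by
  refine ⟨fun n B ↦ aliceAnswer M hfin.toFinset (fun _ ↦ k) (extendMoves B) (n - 1), ?_⟩
  intro n B hB hk A hA
  have hA' (i : Fin n) : A i = aliceAnswer M hfin.toFinset (fun _ ↦ k) (extendMoves B) i := by
    refine (hA i).trans (congrArg _ ?_)
    refine aliceAnswer_congr _ _ _ fun j hj ↦ ?_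
    have := i.isLt
    simp [extendMoves, show j ≤ i by lia, show j < n by lia]
  have hspec (i : ℕ) := (h.of_gameState (extendMoves B) i).aliceMove_spec (extendMoves B i)
  have hdisj {i j : Fin n} (hij : i < j) : Disjoint (A i) (A j) := by
    rw [hA' i, hA' j, disjoint_coe, disjoint_right]
    intro e he
    exact (mem_gameState_fst.1 ((hspec j).1 he)).2 i hij
  refine ⟨fun i ↦ ?_, fun i j hij ↦ ?_, ?_⟩
  · rw [hA' i]
    refine ⟨(hspec i).2.2.1, (hspec i).2.1.trans ?_⟩
    simp [extendMoves]
  · rcases hij.lt_or_gt with hlt | hlt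
    · exact hdisj hlt
    · exact (hdisj hlt).symm
  · refine Set.Subset.antisymm (Set.iUnion_subset fun i ↦ ?_) fun e he ↦ ?_
    · rw [hA' i]
      exact (hspec i).2.2.1.subset_ground
    · by_contra hne
      have hmem : e ∈ (gameState M hfin.toFinset (fun _ ↦ k) (extendMoves B) n).1 := by
        refine mem_gameState_fst.2 ⟨by simpa using he, fun i hi hei ↦ hne ?_⟩
        refine Set.mem_iUnion.2 ⟨⟨i, hi⟩, ?_⟩
        rw [hA']
        exact hei
      obtain ⟨c, hc, -⟩ := h.of_gameState (extendMoves B) n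
      have hlt := hc e hmem
      rw [gameState_snd] at hlt
      have hcard : #{i ∈ range n | e ∈ extendMoves B i} = k := by
        rw [← hk e he, ← Set.ncard_coe_finset, ← Set.ncard_image_of_injective _ Fin.val_injective]
        congr 1
        ext i
        simp only [coe_filter, mem_range, Set.mem_ofPred_eq, Set.mem_image]
        constructor
        · rintro ⟨hi, hei⟩
          exact ⟨⟨i, hi⟩, by simpa [extendMoves, hi] using hei, rfl⟩
        · rintro ⟨j, hj, rfl⟩
          exact ⟨j.isLt, by simpa [extendMoves] using hj⟩
      lia

/-- If Bob always plays the whole ground set, Alice's winning answers form a proper coloring. -/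
lemma exists_coloring_of_matroidOnlineChoosable {M : Matroid α} {k : ℕ}
    (h : matroidOnlineChoosable M k) :
    ∃ c : α → ℕ, (∀ e ∈ M.E, c e < k) ∧ ∀ i : ℕ, M.Indep {e ∈ M.E | c e = i} := by
  rcases M.E.eq_empty_or_nonempty with hE | hE
  · exact ⟨fun _ ↦ 0, by simp [hE], by simp [hE]⟩
  obtain ⟨str, hstr⟩ := h
  obtain ⟨hind, -, hunion⟩ := hstr k (fun _ ↦ M.E) (fun _ ↦ ⟨hE, subset_rfl⟩)
    (fun e he ↦ by simp [he, Set.ncard_univ]) _ fun _ ↦ rfl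
  set A : Fin k → Set α := fun i ↦ str (i + 1) fun _ ↦ M.E
  have hex (e : α) : ∃ i, e ∈ M.E → ∃ hi : i < k, e ∈ A ⟨i, hi⟩ := by
    by_cases he : e ∈ M.E
    · obtain ⟨i, hi⟩ := Set.mem_iUnion.1 (hunion ▸ he)
      exact ⟨i, fun _ ↦ ⟨i.isLt, hi⟩⟩
    · exact ⟨0, fun h ↦ absurd h he⟩
  choose c hc using hex
  refine ⟨c, fun e he ↦ (hc e he).1, fun i ↦ ?_⟩
  by_cases hi : i < k
  · refine (hind ⟨i, hi⟩).1.subset ?_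
    rintro e ⟨he, rfl⟩
    exact (hc e he).2
  · convert M.empty_indep
    ext e
    simp only [Set.mem_ofPred_eq, Set.mem_empty_iff_false, iff_false]
    rintro ⟨he, rfl⟩
    exact hi (hc e he).1

end OnlineColoring

/-- **Every loopless matroid `M` on a finite ground set satisfies `χ̃(M) = χ(M)`.** -/
theorem onlineChromatic_eq_chromatic {α : Type*} (M : Matroid α) (hfin : M.E.Finite)
    (hloopless : ∀ e ∈ M.E, M.Indep {e}) :
    matroidOnlineChromaticNumber M = matroidChromaticNumber M := by
  unfold matroidOnlineChromaticNumber matroidChromaticNumber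
  congr 1
  ext k
  refine ⟨exists_coloring_of_matroidOnlineChoosable, ?_⟩
  rintro ⟨c, hc, hcI⟩
  exact BoundedColorable.matroidOnlineChoosable hfin ⟨c, by simpa using hc, by simpa using hcI⟩
end

section
/- Let M be a loopless matroid on a finite ground set E and let ℓ : E → ℕ. If M is colorable from the lists L(e) = {1, 2, …, ℓ(e)}, e ∈ E (i.e., there is a proper coloring c of M with c(e) ≤ ℓ(e) for all e), then M is colorable from any list assignment L′ with |L′(e)| = ℓ(e) for all e ∈ E, i.e., for every such L′ there is a proper coloring c of M with c(e) ∈ L′(e) for all e. -/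
open Classical in
/-- Partition theorem for two contractions of one integer-valued submodular function. -/
theorem exists_partition_of_submodular {α : Type*} (r : Finset α → ℕ)
    (hr : ∀ S T, r (S ∪ T) + r (S ∩ T) ≤ r S + r T) (J : Finset α) :
    ∀ (A₁ A₂ : Finset α) (k : ℕ), A₁.card + A₂.card ≤ k →
      (∀ S ⊆ J, S.card + k ≤ r (A₁ ∪ S) + r (A₂ ∪ S)) →
      ∃ X ⊆ J, (A₁ ∪ X).card + (A₂ ∪ (J \ X)).card ≤ r (A₁ ∪ X) + r (A₂ ∪ (J \ X)) := by
  induction J using Finset.induction_on with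
  | empty =>
    intro A₁ A₂ k hk h
    refine ⟨∅, subset_rfl, ?_⟩
    have := h ∅ subset_rfl
    simp only [Finset.card_empty, Finset.union_empty, Finset.sdiff_empty] at this ⊢
    omega
  | insert e J he ih =>
    intro A₁ A₂ k hk h
    by_cases h₁ : ∀ S ⊆ J, S.card + (k + 1) ≤ r (insert e A₁ ∪ S) + r (A₂ ∪ S)
    · have hc := Finset.card_insert_le e A₁
      obtain ⟨X, hX, hXr⟩ := ih (insert e A₁) A₂ (k + 1) (by omega) h₁
      refine ⟨insert e X, Finset.insert_subset_insert e hX, ?_⟩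
      have e₁ : A₁ ∪ insert e X = insert e A₁ ∪ X := by grind
      have e₂ : insert e J \ insert e X = J \ X := by grind
      rwa [e₁, e₂]
    by_cases h₂ : ∀ S ⊆ J, S.card + (k + 1) ≤ r (A₁ ∪ S) + r (insert e A₂ ∪ S)
    · have hc := Finset.card_insert_le e A₂
      obtain ⟨X, hX, hXr⟩ := ih A₁ (insert e A₂) (k + 1) (by omega) h₂
      refine ⟨X, hX.trans (Finset.subset_insert e J), ?_⟩
      have e₂ : A₂ ∪ (insert e J \ X) = insert e A₂ ∪ (J \ X) := by grind
      rwa [e₂]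
    push Not at h₁ h₂
    obtain ⟨S, hS, hSr⟩ := h₁
    obtain ⟨T, hT, hTr⟩ := h₂
    have hu := h (insert e (S ∪ T)) (Finset.insert_subset_insert e (Finset.union_subset hS hT))
    have hi := h (S ∩ T) (Finset.inter_subset_left.trans (hS.trans (Finset.subset_insert e J)))
    rw [Finset.card_insert_of_notMem
      (fun h' => he (Finset.union_subset hS hT h'))] at hu
    have hcard := Finset.card_union_add_card_inter S T
    have heS : e ∉ S := fun h' => he (hS h')
    have heT : e ∉ T := fun h' => he (hT h')
    have hr₁ : r (A₁ ∪ insert e (S ∪ T)) + r ((insert e A₁ ∪ S) ∩ (A₁ ∪ T)) ≤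
        r (insert e A₁ ∪ S) + r (A₁ ∪ T) := by
      convert hr (insert e A₁ ∪ S) (A₁ ∪ T) using 3
      grind
    have hr₂ : r (A₂ ∪ insert e (S ∪ T)) + r ((A₂ ∪ S) ∩ (insert e A₂ ∪ T)) ≤
        r (A₂ ∪ S) + r (insert e A₂ ∪ T) := by
      convert hr (A₂ ∪ S) (insert e A₂ ∪ T) using 3
      grind
    have e₁ : (insert e A₁ ∪ S) ∩ (A₁ ∪ T) = A₁ ∪ (S ∩ T) := by grind
    have e₂ : (A₂ ∪ S) ∩ (insert e A₂ ∪ T) = A₂ ∪ (S ∩ T) := by grind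
    rw [e₁] at hr₁
    rw [e₂] at hr₂
    omega

open Classical in
/-- Multiple symmetric exchange for independent sets of a matroid. -/
theorem Matroid.Indep.exists_multiple_exchange {α : Type*} {M : Matroid α} {A₁ A₂ J : Finset α}
    (hA : M.Indep (A₁ ∪ A₂ : Finset α)) (hdisj : Disjoint A₁ A₂) (hJ : M.Indep J) :
    ∃ X ⊆ J, M.Indep (A₁ ∪ X : Finset α) ∧ M.Indep (A₂ ∪ (J \ X) : Finset α) := by
  set r : Finset α → ℕ := fun S => (M.eRk S).toNat with hr_def
  have hr (S : Finset α) : (r S : ℕ∞) = M.eRk S :=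
    ENat.natCast_toNat (M.isRkFinite_of_finite S.finite_toSet).eRk_lt_top.ne
  have hle (S : Finset α) : r S ≤ S.card := by
    have := M.eRk_le_encard S
    rw [← hr, Set.encard_coe_eq_coe_finsetCard] at this
    exact_mod_cast this
  have hindep {S : Finset α} (h : S.card ≤ r S) : M.Indep S := by
    rw [Matroid.indep_iff_eRk_eq_encard_of_finite S.finite_toSet, ← hr,
      Set.encard_coe_eq_coe_finsetCard, le_antisymm (hle S) h]
  have hcard {S : Finset α} (h : M.Indep S) : r S = S.card := by
    have := h.eRk_eq_encard
    rw [← hr, Set.encard_coe_eq_coe_finsetCard] at this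
    exact_mod_cast this
  have hmono {S T : Finset α} (h : S ⊆ T) : r S ≤ r T := by
    have := M.eRk_mono (Finset.coe_subset.2 h)
    rw [← hr, ← hr] at this
    exact_mod_cast this
  have hsub (S T : Finset α) : r (S ∪ T) + r (S ∩ T) ≤ r S + r T := by
    have := M.eRk_inter_add_eRk_union_le S T
    rw [← Finset.coe_inter, ← Finset.coe_union, ← hr, ← hr, ← hr, ← hr] at this
    rw [add_comm]
    exact_mod_cast this
  obtain ⟨X, hX, h⟩ := exists_partition_of_submodular r hsub J A₁ A₂ _ le_rfl (by
    intro S hS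
    have h₁ := hsub (A₁ ∪ S) (A₂ ∪ S)
    have h₂ := hcard (hJ.subset (Finset.coe_subset.2 hS))
    have h₃ : r S ≤ r ((A₁ ∪ S) ∩ (A₂ ∪ S)) := hmono (by grind)
    have h₄ : r (A₁ ∪ A₂) ≤ r ((A₁ ∪ S) ∪ (A₂ ∪ S)) := hmono (by grind)
    rw [hcard hA, Finset.card_union_of_disjoint hdisj] at h₄
    omega)
  have h₁ := hle (A₁ ∪ X)
  have h₂ := hle (A₂ ∪ (J \ X))
  exact ⟨X, hX, hindep (by omega), hindep (by omega)⟩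

/-- From independent sets `V 0, …, V (d - 1)` such that `x ∈ V i` has a list of size greater than
`i`, one can extract an independent set `I` of elements to be colored `k`, such that the remaining
elements are covered in the same way with respect to the lists with `k` removed. -/
theorem Matroid.exists_indep_cover_erase {α : Type*} (M : Matroid α) (L : α → Finset ℕ) (k d : ℕ) :
    ∀ (V : ℕ → Finset α) (C : Finset α), (∀ i < d, M.Indep (V i)) →
      (∀ i < d, ∀ x ∈ V i, i < (L x).card) →
      M.Indep C → (∀ x ∈ C, k ∈ L x ∧ d < (L x).card) →
      ∃ (I : Finset α) (V' : ℕ → Finset α), M.Indep I ∧ (∀ x ∈ I, k ∈ L x) ∧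
        (∀ i < d, M.Indep (V' i)) ∧ (∀ i < d, ∀ x ∈ V' i, i < ((L x).erase k).card) ∧
        ∀ x, (x ∈ C ∨ ∃ i < d, x ∈ V i) → (x ∈ I ∨ ∃ i < d, x ∈ V' i) := by
  classical
  induction d with
  | zero =>
    intro V C _ _ hC hCL
    exact ⟨C, fun _ => ∅, hC, fun x hx => (hCL x hx).1, by simp, by simp, by simp⟩
  | succ d ih =>
    intro V C hV hVL hC hCL
    obtain ⟨X, hX, h₁, h₂⟩ := Matroid.Indep.exists_multiple_exchange
      (A₁ := (V d).filter (k ∉ L ·)) (A₂ := (V d).filter (k ∈ L ·)) (J := C)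
      ((hV d d.lt_succ_self).subset (Finset.coe_subset.2 (by grind)))
      (Finset.disjoint_left.2 (by grind)) hC
    obtain ⟨I, V', hI, hIL, hV', hVL', hcov⟩ := ih V _ (fun i hi => hV i (by omega))
      (fun i hi => hVL i (by omega)) h₂ (by
        intro x hx
        have := hVL d d.lt_succ_self x
        have := hCL x
        grind)
    refine ⟨I, Function.update V' d ((V d).filter (k ∉ L ·) ∪ X), hI, hIL, ?_, ?_, ?_⟩
    · intro i hi
      obtain rfl | hne := eq_or_ne i d
      · rwa [Function.update_self]
      · rw [Function.update_of_ne hne]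
        exact hV' i (by omega)
    · intro i hi x hx
      obtain rfl | hne := eq_or_ne i d
      · rw [Function.update_self] at hx
        have := hVL i hi x
        have := hCL x
        by_cases hk : k ∈ L x
        · rw [Finset.card_erase_of_mem hk]
          grind
        · rw [Finset.erase_eq_of_notMem hk]
          grind
      · rw [Function.update_of_ne hne] at hx
        exact hVL' i (by omega) x hx
    · intro x hx
      by_cases hd : x ∈ (V d).filter (k ∉ L ·) ∪ X
      · exact Or.inr ⟨d, d.lt_succ_self, by rwa [Function.update_self]⟩
      · have hx' : x ∈ (V d).filter (k ∈ L ·) ∪ C \ X ∨ ∃ i < d, x ∈ V i := by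
          obtain hx | ⟨i, hi, hx⟩ := hx
          · left; grind
          · obtain rfl | hne := eq_or_ne i d
            · left; grind
            · exact Or.inr ⟨i, by omega, hx⟩
        obtain h | ⟨i, hi, h⟩ := hcov x hx'
        · exact Or.inl h
        · exact Or.inr ⟨i, by omega, by rwa [Function.update_of_ne hi.ne]⟩

theorem Matroid.exists_indep_list_cover {α : Type*} (M : Matroid α) (d : ℕ) (K : Finset ℕ) :
    ∀ (F : Finset α) (L : α → Finset ℕ) (V : ℕ → Finset α), (∀ x ∈ F, L x ⊆ K) →
      (∀ i < d, M.Indep (V i)) → (∀ i < d, ∀ x ∈ V i, i < (L x).card) →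
      (∀ x ∈ F, ∃ i < d, x ∈ V i) →
      ∃ W : ℕ → Finset α, (∀ i, M.Indep (W i)) ∧ (∀ i, ∀ x ∈ W i, i ∈ L x) ∧
        ∀ x ∈ F, ∃ i, x ∈ W i := by
  classical
  induction K using Finset.induction_on with
  | empty =>
    intro F L V hK _ hVL hF
    refine ⟨fun _ => ∅, by simp, by simp, fun x hx => ?_⟩
    obtain ⟨i, hi, hxi⟩ := hF x hx
    have := hVL i hi x hxi
    simp [Finset.subset_empty.1 (hK x hx)] at this
  | insert k K _ ih =>
    intro F L V hK hV hVL hF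
    obtain ⟨I, V', hI, hIL, hV', hVL', hcov⟩ := M.exists_indep_cover_erase L k d V ∅ hV hVL
      (by simp) (by simp)
    obtain ⟨W, hW, hWL, hWF⟩ := ih (F \ I) (fun x => (L x).erase k) V'
      (fun x hx => by have := hK x; grind) hV' hVL'
      (fun x hx => by
        have := hcov x (Or.inr (hF x (by grind)))
        grind)
    refine ⟨Function.update W k I, fun i => ?_, fun i x hx => ?_, fun x hx => ?_⟩
    · obtain rfl | hne := eq_or_ne i k
      · rwa [Function.update_self]
      · rw [Function.update_of_ne hne]
        exact hW i
    · obtain rfl | hne := eq_or_ne i k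
      · rw [Function.update_self] at hx
        exact hIL x hx
      · rw [Function.update_of_ne hne] at hx
        exact Finset.mem_of_mem_erase (hWL i x hx)
    · by_cases hxI : x ∈ I
      · exact ⟨k, by rwa [Function.update_self]⟩
      · obtain ⟨i, hi⟩ := hWF x (Finset.mem_sdiff.2 ⟨hx, hxI⟩)
        exact ⟨i, by rwa [Function.update_of_ne (Finset.ne_of_mem_erase (hWL i x hi))]⟩


/-- If a loopless matroid `M` on a finite ground set is colorable from the lists
`L e = {1, 2, …, ℓ e}` (i.e. there is a proper coloring `c` with `c e ∈ {1, …, ℓ e}`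
for all `e` in the ground set), then `M` is colorable from *any* list assignment `L'`
with `|L' e| = ℓ e` for all `e`. -/
theorem colorable_of_colorable_initial_lists {α : Type*} (M : Matroid α)
    (hfin : M.E.Finite) (hloopless : ∀ e ∈ M.E, M.Indep {e}) (l : α → ℕ)
    (hcol : ∃ c : α → ℕ, (∀ e ∈ M.E, c e ∈ Finset.Icc 1 (l e)) ∧
      ∀ i : ℕ, M.Indep {e ∈ M.E | c e = i}) :
    ∀ L' : α → Finset ℕ, (∀ e ∈ M.E, (L' e).card = l e) →
      ∃ c : α → ℕ, (∀ e ∈ M.E, c e ∈ L' e) ∧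
        ∀ i : ℕ, M.Indep {e ∈ M.E | c e = i} := by
  classical
  intro L' hL'
  obtain ⟨c, hc, hci⟩ := hcol
  have hmem {x : α} : x ∈ hfin.toFinset ↔ x ∈ M.E := hfin.mem_toFinset
  obtain ⟨W, hW, hWL, hWF⟩ := M.exists_indep_list_cover (hfin.toFinset.sup c)
    (hfin.toFinset.biUnion L') hfin.toFinset L' (fun i => hfin.toFinset.filter (c · = i + 1))
    (fun x hx => Finset.subset_biUnion_of_mem L' hx)
    (fun i _ => (hci (i + 1)).subset (by intro x; simp))
    (fun i _ x hx => by
      rw [Finset.mem_filter, hmem] at hx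
      have := Finset.mem_Icc.1 (hc x hx.1)
      rw [hL' x hx.1]
      omega)
    (fun x hx => by
      have h₁ := Finset.mem_Icc.1 (hc x (hmem.1 hx))
      have h₂ : c x ≤ hfin.toFinset.sup c := Finset.le_sup hx
      exact ⟨c x - 1, by omega, Finset.mem_filter.2 ⟨hx, by omega⟩⟩)
  have hex (x : α) : ∃ i, x ∈ M.E → x ∈ W i := by
    by_cases hx : x ∈ M.E
    · exact (hWF x (hmem.2 hx)).imp fun _ h _ => h
    · exact ⟨0, fun h => absurd h hx⟩
  choose c' hc' using hex
  refine ⟨c', fun e he => hWL _ _ (hc' e he), fun i => (hW i).subset ?_⟩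
  rintro e ⟨he, rfl⟩
  exact hc' e he
end

section
/- Let M be a loopless matroid on a finite ground set E, let w, ℓ : E → ℕ, and suppose M is w-colorable from the lists L(e) = {1, 2, …, ℓ(e)}, e ∈ E. Then M is w-colorable from any list assignment L′ with |L′(e)| = ℓ(e) for every e ∈ E. (Weighted off-line consequence of the on-line theorem.) -/
open Finset in
/-- A Hall-type condition for partitioning `J` into two parts extending `I₁` and `I₂`,
with respect to a matroid rank function `r`. -/
theorem exists_partition_of_card_le_rank {α : Type*} [DecidableEq α] {r : Finset α → ℕ}
    (hmono : ∀ X Y, X ⊆ Y → r X ≤ r Y)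
    (hsub : ∀ X Y, r (X ∪ Y) + r (X ∩ Y) ≤ r X + r Y)
    (hcard : ∀ X, r X ≤ #X) (J I₁ I₂ : Finset α)
    (hall : ∀ A ⊆ J, #A + #I₁ + #I₂ ≤ r (I₁ ∪ A) + r (I₂ ∪ A)) :
    ∃ J₁ J₂, Disjoint J₁ J₂ ∧ J₁ ∪ J₂ = J ∧
      #I₁ + #J₁ ≤ r (I₁ ∪ J₁) ∧ #I₂ + #J₂ ≤ r (I₂ ∪ J₂) := by
  induction hn : #J using Nat.strong_induction_on generalizing J I₁ I₂ with
  | _ n ih =>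
    subst hn
    rcases J.eq_empty_or_nonempty with rfl | ⟨e, he⟩
    · refine ⟨∅, ∅, by simp, by simp, ?_⟩
      have h := hall ∅ (by simp)
      have h₁ := hcard I₁
      have h₂ := hcard I₂
      simp only [union_empty, card_empty] at h ⊢
      omega
    by_cases htight : ∃ A, A ⊂ J ∧ A.Nonempty ∧ r (I₁ ∪ A) + r (I₂ ∪ A) ≤ #A + #I₁ + #I₂
    · obtain ⟨A, hAJ, hA, hAt⟩ := htight
      obtain ⟨A₁, A₂, hd, hu, hA₁, hA₂⟩ := ih #A (card_lt_card hAJ) A I₁ I₂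
        (fun B hB => hall B (hB.trans hAJ.subset)) rfl
      have hAc : #A = #A₁ + #A₂ := by rw [← hu, card_union_of_disjoint hd]
      have hA₁s : A₁ ⊆ A := hu ▸ subset_union_left
      have hA₂s : A₂ ⊆ A := hu ▸ subset_union_right
      have hm₁ := hmono _ _ (union_subset_union_right (s := I₁) hA₁s)
      have hm₂ := hmono _ _ (union_subset_union_right (s := I₂) hA₂s)
      have hc₁ := hcard (I₁ ∪ A₁)
      have hc₂ := hcard (I₂ ∪ A₂)
      have hk₁ := card_union_le I₁ A₁
      have hk₂ := card_union_le I₂ A₂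
      have hspan : ∀ I A' B : Finset α, A' ⊆ A → r (I ∪ A) ≤ r (I ∪ A') →
          r (I ∪ (B ∪ A)) ≤ r (I ∪ A' ∪ B) := by
        intro I A' B hA' hr
        have h₁ := hsub (I ∪ A' ∪ B) (I ∪ A)
        have h₂ := hmono (I ∪ A') ((I ∪ A' ∪ B) ∩ (I ∪ A))
          (subset_inter subset_union_left (union_subset_union_right hA'))
        have h₃ := hmono (I ∪ (B ∪ A)) (I ∪ A' ∪ B ∪ (I ∪ A)) (by
          intro x; simp only [mem_union]; tauto)
        omega
      obtain ⟨K₁, K₂, hKd, hKu, hK₁, hK₂⟩ := ih #(J \ A)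
        (card_lt_card (sdiff_ssubset hAJ.subset hA)) (J \ A) (I₁ ∪ A₁) (I₂ ∪ A₂) (by
          intro B hB
          have hBA : Disjoint B A := disjoint_of_subset_left hB sdiff_disjoint
          have h := hall (B ∪ A) (union_subset (hB.trans sdiff_subset) hAJ.subset)
          have h₁ := hspan I₁ A₁ B hA₁s (by omega)
          have h₂ := hspan I₂ A₂ B hA₂s (by omega)
          rw [card_union_of_disjoint hBA] at h
          omega) rfl
      have hdAK : ∀ A' K, A' ⊆ A → K ⊆ J \ A → Disjoint A' K := fun A' K h₁ h₂ =>
        disjoint_of_subset_left h₁ (disjoint_of_subset_right h₂ disjoint_sdiff)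
      have hK₁s : K₁ ⊆ J \ A := hKu ▸ subset_union_left
      have hK₂s : K₂ ⊆ J \ A := hKu ▸ subset_union_right
      refine ⟨A₁ ∪ K₁, A₂ ∪ K₂, ?_, ?_, ?_, ?_⟩
      · simp only [disjoint_union_left, disjoint_union_right]
        exact ⟨⟨hd, (hdAK _ _ hA₂s hK₁s).symm⟩, hdAK _ _ hA₁s hK₂s, hKd⟩
      · rw [union_union_union_comm, hu, hKu, union_sdiff_of_subset hAJ.subset]
      · rw [← union_assoc]
        have := card_union_le A₁ K₁
        omega
      · rw [← union_assoc]
        have := card_union_le A₂ K₂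
        omega
    · push Not at htight
      have hextend : ∀ I I' : Finset α,
          (∀ A ⊆ J, #A + #I + #I' ≤ r (I ∪ A) + r (I' ∪ A)) →
          (∀ A, A ⊂ J → A.Nonempty → #A + #I + #I' < r (I ∪ A) + r (I' ∪ A)) →
          #I + 1 ≤ r (I ∪ {e}) →
          ∃ K K', Disjoint K K' ∧ K ∪ K' = J ∧ #I + #K ≤ r (I ∪ K) ∧
            #I' + #K' ≤ r (I' ∪ K') := by
        intro I I' hall' hstrict hIe
        have hce := hcard (I ∪ {e})
        have hke := card_union_le I {e}
        rw [card_singleton] at hke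
        obtain ⟨K, K', hd, hu, hK, hK'⟩ := ih #(J.erase e) (card_erase_lt_of_mem he)
          (J.erase e) (I ∪ {e}) I' (by
            intro A hA
            rcases A.eq_empty_or_nonempty with rfl | hAne
            · have h := hall' ∅ (by simp)
              have := hcard I
              simp only [union_empty, card_empty] at h ⊢
              omega
            · have h := hstrict A (hA.trans_ssubset (erase_ssubset he)) hAne
              have := hmono (I ∪ A) (I ∪ {e} ∪ A) (union_subset_union_left subset_union_left)
              omega) rfl
        have heK' : e ∉ K' := fun h => notMem_erase e J (hu ▸ mem_union_right K h)
        refine ⟨{e} ∪ K, K', ?_, ?_, ?_, hK'⟩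
        · rw [disjoint_union_left]
          exact ⟨disjoint_singleton_left.2 heK', hd⟩
        · rw [union_assoc, hu, ← insert_eq, insert_erase he]
        · rw [← union_assoc]
          have := card_union_le {e} K
          rw [card_singleton] at this
          omega
      have h := hall {e} (singleton_subset_iff.2 he)
      rw [card_singleton] at h
      by_cases h₁ : #I₁ + 1 ≤ r (I₁ ∪ {e})
      · exact hextend I₁ I₂ hall htight h₁
      · obtain ⟨K, K', hd, hu, hK, hK'⟩ := hextend I₂ I₁
          (fun A hA => by have := hall A hA; omega)
          (fun A hA hA' => by have := htight A hA hA'; omega) (by omega)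
        exact ⟨K', K, hd.symm, by rwa [union_comm], hK', hK⟩

open Finset in
/-- Multiple exchange for independent sets: if `I₁ ∪ I₂` and `J` are independent, with `I₁` and
`I₂` disjoint, then `J` splits into parts that can be added to `I₁` and `I₂`, respectively. -/
theorem Matroid.Indep.exists_partition_union_indep {α : Type*} [DecidableEq α] {M : Matroid α}
    {I₁ I₂ J : Finset α} (hI : M.Indep ↑(I₁ ∪ I₂)) (hd : Disjoint I₁ I₂) (hJ : M.Indep ↑J) :
    ∃ J₁ J₂, Disjoint J₁ J₂ ∧ J₁ ∪ J₂ = J ∧ Disjoint I₁ J₁ ∧ Disjoint I₂ J₂ ∧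
      M.Indep ↑(I₁ ∪ J₁) ∧ M.Indep ↑(I₂ ∪ J₂) := by
  let r : Finset α → ℕ := fun X => (M.eRk X).toNat
  have hr : ∀ X : Finset α, (r X : ℕ∞) = M.eRk X := fun X =>
    ENat.natCast_toNat (Matroid.eRk_ne_top_iff.2 (M.isRkFinite_of_finite X.finite_toSet))
  have hmono : ∀ X Y, X ⊆ Y → r X ≤ r Y := fun X Y h => by
    have := M.eRk_mono (coe_subset.2 h)
    rwa [← hr, ← hr, Nat.cast_le] at this
  have hsub : ∀ X Y, r (X ∪ Y) + r (X ∩ Y) ≤ r X + r Y := fun X Y => by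
    have := M.eRk_inter_add_eRk_union_le X Y
    rw [← coe_inter, ← coe_union, ← hr, ← hr, ← hr, ← hr] at this
    norm_cast at this
    omega
  have hcard : ∀ X, r X ≤ #X := fun X => by
    have := M.eRk_le_encard X
    rwa [← hr, Set.encard_coe_eq_coe_finsetCard, Nat.cast_le] at this
  have hindep : ∀ X : Finset α, M.Indep X ↔ r X = #X := fun X => by
    rw [Matroid.indep_iff_eRk_eq_encard_of_finite X.finite_toSet, ← hr,
      Set.encard_coe_eq_coe_finsetCard, Nat.cast_inj]
  rw [hindep, card_union_of_disjoint hd] at hI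
  obtain ⟨J₁, J₂, hJd, hJu, h₁, h₂⟩ :=
    exists_partition_of_card_le_rank hmono hsub hcard J I₁ I₂ (by
      intro A hA
      have hAr := (hindep A).1 (hJ.subset (coe_subset.2 hA))
      have h := hsub (I₁ ∪ A) (I₂ ∪ A)
      have hu := hmono (I₁ ∪ I₂) (I₁ ∪ A ∪ (I₂ ∪ A))
        (union_subset_union subset_union_left subset_union_left)
      have hi := hmono A ((I₁ ∪ A) ∩ (I₂ ∪ A))
        (subset_inter subset_union_right subset_union_right)
      omega)
  have hc₁ := hcard (I₁ ∪ J₁)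
  have hc₂ := hcard (I₂ ∪ J₂)
  have hk₁ := card_union_le I₁ J₁
  have hk₂ := card_union_le I₂ J₂
  refine ⟨J₁, J₂, hJd, hJu, card_union_eq_card_add_card.1 (by omega),
    card_union_eq_card_add_card.1 (by omega), (hindep _).2 (by omega), (hindep _).2 (by omega)⟩

open Finset in
/-- Shifting the elements of `B` downwards through the color classes `V n, …, V 1`, starting with
the elements of `S` above `V n`; the elements of `B` pushed out at the bottom form `T`. -/
theorem exists_shifted_classes {α : Type*} [DecidableEq α] {M : Matroid α} (B : Finset α) (n : ℕ)
    (V : ℕ → Finset α) (hV : ∀ i, M.Indep ↑(V i)) (S : Finset α) (hSB : S ⊆ B)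
    (hS : M.Indep ↑S) :
    ∃ (V' : ℕ → Finset α) (T : Finset α), (∀ i, M.Indep ↑(V' i)) ∧ T ⊆ B ∧ M.Indep ↑T ∧
      (∀ i, ∀ e ∉ B, e ∈ V' i → e ∈ V i) ∧
      (∀ i ∈ Icc 1 n, ∀ e ∈ V' i, e ∈ B → e ∈ S ∨ ∃ j ∈ Icc 1 n, i < j ∧ e ∈ V j) ∧
      ∀ e, #{i ∈ Icc 1 n | e ∈ V i} + (if e ∈ S then 1 else 0) =
        #{i ∈ Icc 1 n | e ∈ V' i} + (if e ∈ T then 1 else 0) := by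
  induction n generalizing S with
  | zero => exact ⟨V, S, hV, hSB, hS, fun _ _ _ h => h, by simp, by simp⟩
  | succ n ih =>
    obtain ⟨S₁, S₂, hd, hu, hd₁, hd₂, h₁, h₂⟩ :=
      Matroid.Indep.exists_partition_union_indep (I₁ := V (n + 1) \ B) (I₂ := V (n + 1) ∩ B)
        (by rw [sdiff_union_inter]; exact hV _) (disjoint_sdiff_inter _ _) hS
    have hS₁ : S₁ ⊆ S := hu ▸ subset_union_left
    have hS₂ : S₂ ⊆ S := hu ▸ subset_union_right
    obtain ⟨V', T, hV', hTB, hT, hout, hin, hcount⟩ := ih (V (n + 1) ∩ B ∪ S₂)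
      (union_subset inter_subset_right (hS₂.trans hSB)) h₂
    refine ⟨Function.update V' (n + 1) (V (n + 1) \ B ∪ S₁), T, ?_, hTB, hT, ?_, ?_, ?_⟩
    · intro i
      rcases eq_or_ne i (n + 1) with rfl | hi
      · simpa using h₁
      · simpa [hi] using hV' i
    · intro i e he hei
      rcases eq_or_ne i (n + 1) with rfl | hi
      · simp only [Function.update_self, mem_union, mem_sdiff] at hei
        exact hei.elim (fun h => h.1) fun h => absurd (hSB (hS₁ h)) he
      · rw [Function.update_of_ne hi] at hei
        exact hout i e he hei
    · intro i hi e hei heB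
      rcases eq_or_ne i (n + 1) with rfl | hne
      · simp only [Function.update_self, mem_union, mem_sdiff] at hei
        exact Or.inl (hei.elim (fun h => absurd heB h.2) fun h => hS₁ h)
      · rw [Function.update_of_ne hne] at hei
        rw [mem_Icc] at hi
        rcases hin i (mem_Icc.2 (by omega)) e hei heB with h | ⟨j, hj, hij, hej⟩
        · rcases mem_union.1 h with h | h
          · exact Or.inr ⟨n + 1, by simp, by omega, (mem_inter.1 h).1⟩
          · exact Or.inl (hS₂ h)
        · rw [mem_Icc] at hj
          exact Or.inr ⟨j, mem_Icc.2 (by omega), hij, hej⟩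
    · intro e
      have hsplit : ∀ U : ℕ → Finset α, #{i ∈ Icc 1 (n + 1) | e ∈ U i} =
          #{i ∈ Icc 1 n | e ∈ U i} + if e ∈ U (n + 1) then 1 else 0 := fun U => by
        simp only [card_filter]
        exact sum_Icc_succ_top (by omega) _
      have hcongr : #{i ∈ Icc 1 n | e ∈ Function.update V' (n + 1) (V (n + 1) \ B ∪ S₁) i} =
          #{i ∈ Icc 1 n | e ∈ V' i} := by
        congr 1
        refine filter_congr fun i hi => ?_
        rw [mem_Icc] at hi
        rw [Function.update_of_ne (by omega)]
      have hc := hcount e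
      rw [hsplit, hsplit, hcongr, Function.update_self]
      have hSe : e ∈ S ↔ e ∈ S₁ ∨ e ∈ S₂ := by rw [← hu, mem_union]
      have hde : e ∈ S₁ → e ∉ S₂ := fun h => disjoint_left.1 hd h
      have hde₁ : e ∈ V (n + 1) \ B → e ∉ S₁ := fun h => disjoint_left.1 hd₁ h
      have hde₂ : e ∈ V (n + 1) ∩ B → e ∉ S₂ := fun h => disjoint_left.1 hd₂ h
      simp only [mem_union, mem_inter, mem_sdiff, hSe] at hc hde₁ hde₂ ⊢
      clear * - hc hde hde₁ hde₂
      by_cases hV₁ : e ∈ V (n + 1) <;> by_cases hB : e ∈ B <;> by_cases hs₁ : e ∈ S₁ <;>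
        by_cases hs₂ : e ∈ S₂ <;> simp_all <;> omega


/-- **Weighted off-line consequence of the on-line theorem.**
Let `M` be a loopless matroid on a finite ground set and `w ℓ : E → ℕ`.  A `w`-coloring
of `M` is a function `W` assigning to each element a set of colors with `|W e| = w e`
such that for every color `i` the set `{e : i ∈ W e}` is independent.  If `M` is
`w`-colorable from the lists `L e = {1, 2, …, ℓ e}`, then `M` is `w`-colorable from any
list assignment `L'` with `|L' e| = ℓ e` for every `e`. -/
theorem weighted_colorable_of_colorable_initial_lists {α : Type*} (M : Matroid α)
    (hfin : M.E.Finite) (hloopless : ∀ e ∈ M.E, M.Indep {e}) (w l : α → ℕ)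
    (hcol : ∃ W : α → Finset ℕ, (∀ e ∈ M.E, W e ⊆ Finset.Icc 1 (l e)) ∧
      (∀ e ∈ M.E, (W e).card = w e) ∧
      ∀ i : ℕ, M.Indep {e ∈ M.E | i ∈ W e}) :
    ∀ L' : α → Finset ℕ, (∀ e ∈ M.E, (L' e).card = l e) →
      ∃ W : α → Finset ℕ, (∀ e ∈ M.E, W e ⊆ L' e) ∧
        (∀ e ∈ M.E, (W e).card = w e) ∧
        ∀ i : ℕ, M.Indep {e ∈ M.E | i ∈ W e} := by
  classical
  intro L'
  have hcover : ∀ e ∈ M.E, L' e ⊆ hfin.toFinset.biUnion L' := fun e he =>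
    Finset.subset_biUnion_of_mem L' (hfin.mem_toFinset.2 he)
  generalize hfin.toFinset.biUnion L' = C at hcover
  induction C using Finset.induction_on generalizing w l L' with
  | empty =>
    intro hL
    obtain ⟨W, hWl, hWw, hWi⟩ := hcol
    refine ⟨W, fun e he => ?_, hWw, hWi⟩
    have h0 : l e = 0 := by
      rw [← hL e he, Finset.subset_empty.1 (hcover e he), Finset.card_empty]
    have := hWl e he
    rw [h0] at this
    exact this.trans (by simp)
  | insert c C hc ih =>
    intro hL
    obtain ⟨W, hWl, hWw, hWi⟩ := hcol
    have hsubset : ∀ e ∈ M.E, L' e \ {c} ⊆ C := fun e he => by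
      rw [Finset.sdiff_singleton_eq_erase, ← Finset.subset_insert_iff]
      exact hcover e he
    let E := hfin.toFinset
    have hE : ∀ e, e ∈ E ↔ e ∈ M.E := fun e => hfin.mem_toFinset
    let B : Finset α := {e ∈ E | c ∈ L' e}
    have hB : ∀ e ∈ M.E, e ∈ B ↔ c ∈ L' e := fun e he => by
      simp [B, hE, he]
    let V : ℕ → Finset α := fun i => {e ∈ E | i ∈ W e}
    have hV : ∀ e ∈ M.E, ∀ i, e ∈ V i ↔ i ∈ W e := fun e he i => by simp [V, hE, he]
    have hVi : ∀ i, M.Indep ↑(V i) := fun i => by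
      convert hWi i using 1
      ext e
      simp [V, hE]
    let n := E.sup l
    have hln : ∀ e ∈ M.E, l e ≤ n := fun e he => Finset.le_sup ((hE e).2 he)
    obtain ⟨V', T, hV', hTB, hT, hout, hin, hcount⟩ :=
      exists_shifted_classes B n V hVi ∅ (Finset.empty_subset _) (by simp)
    have hcount' : ∀ e ∈ M.E, (W e).card =
        ({i ∈ Finset.Icc 1 n | e ∈ V' i} : Finset ℕ).card + if e ∈ T then 1 else 0 := by
      intro e he
      rw [← hcount e, if_neg (Finset.notMem_empty e), add_zero]
      congr 1
      ext i
      simp only [Finset.mem_filter, hV e he]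
      exact ⟨fun h => ⟨Finset.Icc_subset_Icc_right (hln e he) (hWl e he h), h⟩, fun h => h.2⟩
    obtain ⟨U, hUL, hUw, hUi⟩ : ∃ U : α → Finset ℕ, (∀ e ∈ M.E, U e ⊆ L' e \ {c}) ∧
        (∀ e ∈ M.E, (U e).card = w e - if e ∈ T then 1 else 0) ∧
        ∀ i : ℕ, M.Indep {e ∈ M.E | i ∈ U e} := by
      refine ih (fun e => w e - if e ∈ T then 1 else 0)
        (fun e => l e - if e ∈ B then 1 else 0)
        ⟨fun e => {i ∈ Finset.Icc 1 n | e ∈ V' i}, ?_, ?_, ?_⟩ (fun e => L' e \ {c}) hsubset ?_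
      · intro e he i hi
        rw [Finset.mem_filter] at hi
        obtain ⟨hin', hei⟩ := hi
        have hi1 := (Finset.mem_Icc.1 hin').1
        rw [Finset.mem_Icc]
        refine ⟨hi1, ?_⟩
        split_ifs with heB
        · rcases hin i hin' e hei heB with h | ⟨j, -, hij, hej⟩
          · simp at h
          · have := Finset.mem_Icc.1 (hWl e he ((hV e he j).1 hej))
            omega
        · have := Finset.mem_Icc.1 (hWl e he ((hV e he i).1 (hout i e heB hei)))
          omega
      · intro e he
        have h := hcount' e he
        rw [hWw e he] at h
        dsimp only
        omega
      · intro i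
        refine (hV' i).subset fun e he => ?_
        exact (Finset.mem_filter.1 he.2).2
      · intro e he
        rw [← hL e he]
        split_ifs with heB
        · rw [Finset.card_sdiff_of_subset (Finset.singleton_subset_iff.2 ((hB e he).1 heB)),
            Finset.card_singleton]
        · rw [Finset.sdiff_singleton_eq_erase,
            Finset.erase_eq_of_notMem (fun h => heB ((hB e he).2 h)), Nat.sub_zero]
    refine ⟨fun e => if e ∈ T then insert c (U e) else U e, ?_, ?_, ?_⟩
    · intro e he
      have hU := (hUL e he).trans Finset.sdiff_subset
      dsimp only
      split_ifs with heT
      · exact Finset.insert_subset ((hB e he).1 (hTB heT)) hU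
      · exact hU
    · intro e he
      have hcU : c ∉ U e := fun h => by simpa using hUL e he h
      have h₁ := hUw e he
      have h₂ := hcount' e he
      rw [hWw e he] at h₂
      dsimp only at h₁ ⊢
      split_ifs with heT
      · rw [if_pos heT] at h₁ h₂
        rw [Finset.card_insert_of_notMem hcU]
        omega
      · rwa [if_neg heT] at h₁
    · intro i
      rcases eq_or_ne i c with rfl | hi
      · refine hT.subset fun e he => ?_
        by_contra heT
        rw [Finset.mem_coe] at heT
        have h := he.2
        dsimp only at h
        rw [if_neg heT] at h
        simpa using hUL e he.1 h
      · refine (hUi i).subset fun e he => ⟨he.1, ?_⟩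
        have h := he.2
        dsimp only at h
        split_ifs at h
        · exact (Finset.mem_insert.1 h).resolve_left hi
        · exact h
end
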